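/- arXiv:0711.4093 — 2 statements merged into one kernel-verified Lean document; each statement's English description precedes it below -/
import Mathlib

section
/- Let k ≥ 6 and let Y be a k-large simplicial complex. If p : X → Y is the universal cover of Y and m < (k−1)/2, then for every i = 0, 1, …, m and every simplex σ of X, the restriction p|_{B_i(σ,X)} : B_i(σ,X) → p(B_i(σ,X)) is an isomorphism of simplicial complexes. -/
universe u

/-- An abstract simplicial complex on a vertex type `V`: a downward-closed
family of nonempty finite subsets of `V`. -/
structure SComplex (V : Type u) where
  faces : Set (Finset V)
  nonempty_of_mem : ∀ σ ∈ faces, σ.Nonempty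
  down_closed : ∀ σ ∈ faces, ∀ τ : Finset V, τ ⊆ σ → τ.Nonempty → τ ∈ faces

namespace SComplex

variable {V : Type u} [DecidableEq V]

/-- The vertex set of a simplicial complex. -/
def vertexSet (X : SComplex V) : Set V := {v | ({v} : Finset V) ∈ X.faces}

/-- The geometric realization of a simplicial complex: the set of barycentric
coordinate functions supported on a simplex, inside the product space `V → ℝ`. -/
def realization (X : SComplex V) : Set (V → ℝ) :=
  {f | (∀ v, 0 ≤ f v) ∧ ∃ σ ∈ X.faces, (∀ v, v ∉ σ → f v = 0) ∧ ∑ v ∈ σ, f v = 1}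

/-- `Y` is a subcomplex of `X`. -/
def IsSubcomplexOf (Y X : SComplex V) : Prop := Y.faces ⊆ X.faces

/-- `Y` is a full subcomplex of `X`. -/
def IsFullSubcomplexOf (Y X : SComplex V) : Prop :=
  Y.faces ⊆ X.faces ∧
    ∀ σ ∈ X.faces, (∀ v ∈ σ, ({v} : Finset V) ∈ Y.faces) → σ ∈ Y.faces

/-- The full subcomplex of `X` spanned by a set `W` of vertices. -/
def restrict (X : SComplex V) (W : Set V) : SComplex V where
  faces := {σ | σ ∈ X.faces ∧ ∀ v ∈ σ, v ∈ W}
  nonempty_of_mem := fun σ h => X.nonempty_of_mem σ h.1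
  down_closed := fun σ h τ hτ hne =>
    ⟨X.down_closed σ h.1 τ hτ hne, fun v hv => h.2 v (hτ hv)⟩

/-- The link of a simplex `σ` in `X`. -/
def link (X : SComplex V) (σ : Finset V) : SComplex V where
  faces := {τ | τ ∈ X.faces ∧ Disjoint τ σ ∧ τ ∪ σ ∈ X.faces}
  nonempty_of_mem := fun τ h => X.nonempty_of_mem τ h.1
  down_closed := by
    rintro τ ⟨hτ, hdisj, hunion⟩ ρ hρ hne
    refine ⟨X.down_closed τ hτ ρ hρ hne, ?_, ?_⟩
    · exact Finset.disjoint_left.mpr fun a ha hb => Finset.disjoint_left.mp hdisj (hρ ha) hb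
    · exact X.down_closed _ hunion _ (Finset.union_subset_union hρ (subset_refl σ))
        (hne.mono Finset.subset_union_left)

/-- A combinatorial cycle of length `m` in `X` (a subcomplex homeomorphic to a circle):
an injective enumeration of `m` vertices, consecutive ones joined by edges of `X`. -/
def IsCycle (X : SComplex V) (m : ℕ) (γ : ZMod m → V) : Prop :=
  3 ≤ m ∧ Function.Injective γ ∧ ∀ i : ZMod m, ({γ i, γ (i + 1)} : Finset V) ∈ X.faces

/-- The cycle `γ` has a diagonal: an edge of `X` joining two nonconsecutive vertices. -/
def HasDiagonal (X : SComplex V) (m : ℕ) (γ : ZMod m → V) : Prop :=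
  ∃ i j : ZMod m, j ≠ i ∧ j ≠ i + 1 ∧ j ≠ i - 1 ∧ ({γ i, γ j} : Finset V) ∈ X.faces

/-- A simplicial complex is flag if every finite set of vertices pairwise joined
by edges spans a simplex. -/
def Flag (X : SComplex V) : Prop :=
  ∀ A : Finset V, A.Nonempty → (∀ v ∈ A, ({v} : Finset V) ∈ X.faces) →
    (∀ v ∈ A, ∀ w ∈ A, v ≠ w → ({v, w} : Finset V) ∈ X.faces) → A ∈ X.faces

/-- A simplicial complex is `k`-large if it is flag and every cycle of length
`4 ≤ |γ| < k` has a diagonal. -/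
def KLarge (k : ℕ) (X : SComplex V) : Prop :=
  X.Flag ∧ ∀ (m : ℕ) (γ : ZMod m → V), X.IsCycle m γ → 4 ≤ m → m < k → X.HasDiagonal m γ

/-- A simplicial complex is locally `k`-large if all links of its (nonempty) simplices
are `k`-large. -/
def LocallyKLarge (k : ℕ) (X : SComplex V) : Prop :=
  ∀ σ ∈ X.faces, KLarge k (X.link σ)

/-- A systolic complex: connected, simply connected and locally `6`-large. -/
def Systolic (X : SComplex V) : Prop :=
  LocallyKLarge 6 X ∧ ConnectedSpace X.realization ∧ SimplyConnectedSpace X.realization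

/-- A simplicial complex is locally finite if every vertex belongs to finitely
many simplices. -/
def LocallyFinite (X : SComplex V) : Prop :=
  ∀ v : V, {σ ∈ X.faces | v ∈ σ}.Finite

/-- The faces of the closed combinatorial ball of radius `i` around the simplex `σ`:
`B_0 = σ` and `B_{i+1}` is the union of all closed simplices meeting `B_i`. -/
def ballFaces (X : SComplex V) (σ : Finset V) : ℕ → Set (Finset V)
  | 0 => {τ | τ ∈ X.faces ∧ τ ⊆ σ}
  | i + 1 => {ρ | ρ ∈ X.faces ∧ ∃ τ ∈ X.faces, ρ ⊆ τ ∧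
      ∃ v ∈ τ, ({v} : Finset V) ∈ X.ballFaces σ i}

/-- The closed combinatorial ball of radius `i` around `σ`, as a subcomplex. -/
def ball (X : SComplex V) (σ : Finset V) (i : ℕ) : SComplex V where
  faces := X.ballFaces σ i
  nonempty_of_mem := by
    cases i with
    | zero => exact fun τ h => X.nonempty_of_mem τ h.1
    | succ n => exact fun τ h => X.nonempty_of_mem τ h.1
  down_closed := by
    cases i with
    | zero => exact fun τ h ρ hsub hne =>
        ⟨X.down_closed τ h.1 ρ hsub hne, hsub.trans h.2⟩
    | succ n =>
        rintro τ ⟨hτ, μ, hμ, hsub2, v, hv, hball⟩ ρ hsub hne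
        exact ⟨X.down_closed τ hτ ρ hsub hne, μ, hμ, hsub.trans hsub2, v, hv, hball⟩

/-- The faces of the combinatorial sphere of radius `i` around `σ`: the faces of the
ball `B_i` all of whose vertices are at combinatorial distance exactly `i` from `σ`. -/
def sphereFaces (X : SComplex V) (σ : Finset V) : ℕ → Set (Finset V)
  | 0 => X.ballFaces σ 0
  | i + 1 => {τ | τ ∈ X.ballFaces σ (i + 1) ∧
      ∀ v ∈ τ, ({v} : Finset V) ∉ X.ballFaces σ i}

/-- The combinatorial sphere of radius `i` around `σ`, as a subcomplex: the subcomplex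
of `B_i` spanned by the vertices at combinatorial distance `i` from `σ`. -/
def sphere (X : SComplex V) (σ : Finset V) (i : ℕ) : SComplex V where
  faces := X.sphereFaces σ i
  nonempty_of_mem := by
    cases i with
    | zero => exact fun τ h => (X.ball σ 0).nonempty_of_mem τ h
    | succ n => exact fun τ h => (X.ball σ (n + 1)).nonempty_of_mem τ h.1
  down_closed := by
    cases i with
    | zero => exact fun τ h ρ hsub hne => (X.ball σ 0).down_closed τ h ρ hsub hne
    | succ n =>
        rintro τ ⟨hτ, hout⟩ ρ hsub hne
        exact ⟨(X.ball σ (n + 1)).down_closed τ hτ ρ hsub hne,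
          fun v hv => hout v (hsub hv)⟩

/-- The condition `R(v,X)`: for every simplex `σ` of the link `X_v`, the complement
in `X_v` of the open combinatorial ball of radius `2` around `σ` (i.e. the full
subcomplex of `X_v` spanned by the vertices at combinatorial distance at least `2`
from `σ`) is connected. -/
def CondR (X : SComplex V) (v : V) : Prop :=
  ∀ σ ∈ (X.link {v}).faces,
    ConnectedSpace
      ((X.link {v}).restrict
        {w | ({w} : Finset V) ∉ (X.link {v}).ballFaces σ 1}).realization

/-- A chamber complex of dimension `n`: every simplex is contained in a simplex with
`n+1` vertices (a chamber), there are no larger simplices, and every codimension-one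
face lies in at least two chambers. -/
def IsChamberComplex (X : SComplex V) (n : ℕ) : Prop :=
  (∀ σ ∈ X.faces, σ.card ≤ n + 1) ∧
  (∀ σ ∈ X.faces, ∃ τ ∈ X.faces, σ ⊆ τ ∧ τ.card = n + 1) ∧
  (∀ σ ∈ X.faces, σ.card = n →
    ∃ τ₁ ∈ X.faces, ∃ τ₂ ∈ X.faces, τ₁ ≠ τ₂ ∧ σ ⊆ τ₁ ∧ σ ⊆ τ₂ ∧
      τ₁.card = n + 1 ∧ τ₂.card = n + 1)

/-- Two chambers of an `n`-dimensional chamber complex are adjacent if they share a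
codimension-one face. -/
def ChamberAdj (X : SComplex V) (n : ℕ) (σ τ : Finset V) : Prop :=
  σ ∈ X.faces ∧ τ ∈ X.faces ∧ σ.card = n + 1 ∧ τ.card = n + 1 ∧
    ∃ ρ ∈ X.faces, ρ.card = n ∧ ρ ⊆ σ ∧ ρ ⊆ τ

/-- A chamber complex is gallery connected if any two chambers are joined by a gallery. -/
def GalleryConnected (X : SComplex V) (n : ℕ) : Prop :=
  ∀ σ ∈ X.faces, σ.card = n + 1 → ∀ τ ∈ X.faces, τ.card = n + 1 →
    Relation.ReflTransGen (X.ChamberAdj n) σ τ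

/-- A normal chamber complex: gallery connected, with all links of dimension above `0`
gallery connected. -/
def IsNormalChamberComplex (X : SComplex V) (n : ℕ) : Prop :=
  IsChamberComplex X n ∧ GalleryConnected X n ∧
    ∀ σ ∈ X.faces, σ.card ≤ n - 1 → GalleryConnected (X.link σ) (n - σ.card)

/-- A pseudomanifold of dimension `n`: a chamber complex in which every codimension-one
face belongs to exactly two chambers. -/
def IsPseudomanifold (X : SComplex V) (n : ℕ) : Prop :=
  IsChamberComplex X n ∧
    ∀ σ ∈ X.faces, σ.card = n →
      ({τ | τ ∈ X.faces ∧ σ ⊆ τ ∧ τ.card = n + 1} : Set (Finset V)).ncard = 2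

/-- The dimension of a (finite-dimensional) simplicial complex. -/
noncomputable def dim (X : SComplex V) : ℕ := sSup {n : ℕ | ∃ σ ∈ X.faces, σ.card = n + 1}

/-- A simplicial complex is finite dimensional. -/
def IsFiniteDimensional (X : SComplex V) : Prop :=
  ∃ N : ℕ, ∀ σ ∈ X.faces, σ.card ≤ N + 1

end SComplex
/-- A simplicial covering map: a vertex map sending simplices injectively onto
simplices, surjective on simplices, with unique lifting of simplices at vertices. -/
def IsSimplicialCovering {V W : Type} [DecidableEq V] [DecidableEq W]
    (p : V → W) (X : SComplex V) (Y : SComplex W) : Prop :=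
  (∀ σ ∈ X.faces, σ.image p ∈ Y.faces ∧ Set.InjOn p (σ : Set V)) ∧
  (∀ τ ∈ Y.faces, ∃ σ ∈ X.faces, σ.image p = τ) ∧
  (∀ v : V, ({v} : Finset V) ∈ X.faces → ∀ τ ∈ Y.faces, p v ∈ τ →
    ∃! σ : Finset V, σ ∈ X.faces ∧ v ∈ σ ∧ σ.image p = τ)

/-- `p : X → Y` is the universal cover of `Y`: a simplicial covering with `X`
connected and simply connected. -/
def IsUniversalCover {V W : Type} [DecidableEq V] [DecidableEq W]
    (p : V → W) (X : SComplex V) (Y : SComplex W) : Prop :=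
  IsSimplicialCovering p X Y ∧ ConnectedSpace X.realization ∧
    SimplyConnectedSpace X.realization
namespace IsSimplicialCovering

variable {V W : Type} [DecidableEq V] [DecidableEq W] {p : V → W} {X : SComplex V}
  {Y : SComplex W}

/-- Edges at a common vertex with the same image have the same endpoint. -/
theorem eq_of_edge (h : IsSimplicialCovering p X Y) {u a b : V}
    (ha : ({u, a} : Finset V) ∈ X.faces) (hb : ({u, b} : Finset V) ∈ X.faces)
    (hab : p a = p b) : a = b := by
  have hu : ({u} : Finset V) ∈ X.faces := X.down_closed _ ha _ (by simp) (by simp)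
  obtain ⟨_, -, huniq⟩ := h.2.2 u hu _ (h.1 _ ha).1 (by simp)
  have hE : ({u, a} : Finset V) = {u, b} :=
    (huniq _ ⟨ha, by simp, rfl⟩).trans
      (huniq _ ⟨hb, by simp, by simp [Finset.image_insert, hab]⟩).symm
  exact (h.1 _ ha).2 (by simp) (by rw [hE]; simp) hab

/-- Edges of the base lift at every vertex over one of their endpoints. -/
theorem exists_lift_edge (h : IsSimplicialCovering p X Y) {u : V} {y : W}
    (hu : ({u} : Finset V) ∈ X.faces) (hy : ({p u, y} : Finset W) ∈ Y.faces) :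
    ∃ w, ({u, w} : Finset V) ∈ X.faces ∧ p w = y := by
  obtain ⟨σ, ⟨hσ, huσ, himg⟩, -⟩ := h.2.2 u hu _ hy (by simp)
  obtain ⟨w, hw, rfl⟩ : ∃ w ∈ σ, p w = y := by
    rw [← Finset.mem_image, himg]; simp
  exact ⟨w, X.down_closed _ hσ _ (by simp [Finset.insert_subset_iff, huσ, hw]) (by simp), rfl⟩

/-- If `u` is adjacent to `a` and `b`, and the images of `u`, `a`, `b` lie in a common simplex,
then `a` and `b` are adjacent. -/
theorem edge_of_triangle (h : IsSimplicialCovering p X Y) {u a b : V}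
    (ha : ({u, a} : Finset V) ∈ X.faces) (hb : ({u, b} : Finset V) ∈ X.faces)
    (ht : ({p u, p a, p b} : Finset W) ∈ Y.faces) : ({a, b} : Finset V) ∈ X.faces := by
  have hu : ({u} : Finset V) ∈ X.faces := X.down_closed _ ha _ (by simp) (by simp)
  obtain ⟨σ, ⟨hσ, huσ, himg⟩, -⟩ := h.2.2 u hu _ ht (by simp)
  have lift_mem : ∀ c, ({u, c} : Finset V) ∈ X.faces →
      p c ∈ ({p u, p a, p b} : Finset W) → c ∈ σ := by
    intro c hc hpc
    rw [← himg, Finset.mem_image] at hpc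
    obtain ⟨w, hw, hwc⟩ := hpc
    have hE : ({u, w} : Finset V) ∈ X.faces :=
      X.down_closed _ hσ _ (by simp [Finset.insert_subset_iff, huσ, hw]) (by simp)
    rwa [h.eq_of_edge hc hE hwc.symm]
  exact X.down_closed _ hσ _
    (by simp [Finset.insert_subset_iff, lift_mem a ha, lift_mem b hb]) (by simp)

end IsSimplicialCovering

namespace SComplex

/-- The first `n` steps of `f` form a walk in `X`; constant steps are allowed. -/
def IsWalk {V : Type u} [DecidableEq V] (X : SComplex V) (n : ℕ) (f : ℕ → V) : Prop :=
  ∀ t < n, ({f t, f (t + 1)} : Finset V) ∈ X.faces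

theorem IsWalk.shift {V : Type u} [DecidableEq V] {X : SComplex V} {n : ℕ} {f : ℕ → V}
    (hf : X.IsWalk n f) {i l : ℕ} (h : i + l ≤ n) : X.IsWalk l fun t => f (i + t) :=
  fun t ht => hf (i + t) (by omega)

/-- Skip `d` vertices of a walk after the position `i`. -/
theorem IsWalk.skip {V : Type u} [DecidableEq V] {X : SComplex V} {n : ℕ} {f : ℕ → V}
    (hf : X.IsWalk n f) {i d : ℕ}
    (h : i + 1 + d ≤ n → ({f i, f (i + 1 + d)} : Finset V) ∈ X.faces) :
    X.IsWalk (n - d) fun t => if t ≤ i then f t else f (t + d) := by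
  intro t ht
  rcases lt_trichotomy t i with hti | rfl | hti
  · simpa [hti.le, Nat.succ_le_of_lt hti] using hf t (by omega)
  · simpa using h (by omega)
  · have := hf (t + d) (by omega)
    simpa [hti.not_ge, hti.not_gt, (by omega : t + 1 + d = t + d + 1)] using this

/-- Prepend a vertex to a walk. -/
theorem IsWalk.cons {V : Type u} [DecidableEq V] {X : SComplex V} {n : ℕ} {f : ℕ → V}
    (hf : X.IsWalk n f) {w : V} (hw : ({w, f 0} : Finset V) ∈ X.faces) :
    X.IsWalk (n + 1) fun t => if t = 0 then w else f (t - 1) := by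
  rintro (_ | t) ht
  · simpa using hw
  · simpa using hf t (by omega)

/-- Join the reversal of a walk to another walk along an edge. -/
theorem IsWalk.reverse_append {V : Type u} [DecidableEq V] {X : SComplex V} {n m : ℕ}
    {f g : ℕ → V} (hf : X.IsWalk n f) (hg : X.IsWalk m g)
    (h : ({f 0, g 0} : Finset V) ∈ X.faces) :
    X.IsWalk (n + m + 1) fun t => if t ≤ n then f (n - t) else g (t - n - 1) := by
  intro t ht
  rcases lt_trichotomy t n with htn | rfl | htn
  · have := hf (n - (t + 1)) (by omega)
    rw [show n - (t + 1) + 1 = n - t by omega, Finset.pair_comm] at this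
    simpa [htn.le, Nat.succ_le_of_lt htn] using this
  · simpa using h
  · have := hg (t - n - 1) (by omega)
    rw [show t - n - 1 + 1 = t + 1 - n - 1 by omega] at this
    simpa [htn.not_ge, htn.not_gt] using this

/-- A vertex of the ball of radius `i` is the end of a walk of length `i` starting in the centre. -/
theorem exists_walk_of_mem_ballFaces {V : Type u} [DecidableEq V] {X : SComplex V}
    {σ : Finset V} {i : ℕ} {v : V} (hv : ({v} : Finset V) ∈ X.ballFaces σ i) :
    ∃ f : ℕ → V, X.IsWalk i f ∧ f 0 ∈ σ ∧ f i = v := by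
  induction i generalizing v with
  | zero => exact ⟨fun _ => v, fun t ht => absurd ht (by omega), hv.2 (by simp), rfl⟩
  | succ i ih =>
    obtain ⟨-, τ, hτ, hvτ, w, hw, hwi⟩ := hv
    obtain ⟨f, hf, h0, rfl⟩ := ih hwi
    refine ⟨fun t => if t ≤ i then f t else v, fun t ht => ?_, by simpa using h0, by simp⟩
    rcases (Nat.lt_succ_iff.mp ht).lt_or_eq with hti | rfl
    · simpa [hti.le, Nat.succ_le_of_lt hti] using hf t hti
    · simpa using X.down_closed _ hτ {f t, v}
        (by simpa [Finset.insert_subset_iff, hw] using hvτ) (by simp)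

/-- An injective closed walk of length `4 ≤ n < k` in a `k`-large complex has a diagonal. -/
theorem KLarge.exists_diagonal {V : Type u} [DecidableEq V] {Y : SComplex V} {k n : ℕ}
    (hY : Y.KLarge k) (hn : 4 ≤ n) (hnk : n < k) {g : ℕ → V} (hg : Y.IsWalk n g)
    (hclosed : g 0 = g n) (hinj : ∀ i j, i < j → j < n → g i ≠ g j) :
    ∃ i j, i + 2 ≤ j ∧ j < n ∧ j < i + n - 1 ∧ ({g i, g j} : Finset V) ∈ Y.faces := by
  have : NeZero n := ⟨by omega⟩
  have : Fact (1 < n) := ⟨by omega⟩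
  have val_succ (x : ZMod n) : (x + 1).val = (x.val + 1) % n := by
    rw [ZMod.val_add, ZMod.val_one]
  have succ_ne {x y : ZMod n} (h : y ≠ x + 1) : y.val ≠ (x.val + 1) % n := fun e =>
    h (ZMod.val_injective n (e.trans (val_succ x).symm))
  have ordered (x y : ZMod n) (hlt : x.val < y.val) (h₁ : y ≠ x + 1) (h₂ : x ≠ y + 1)
      (he : ({g x.val, g y.val} : Finset V) ∈ Y.faces) :
      ∃ i j, i + 2 ≤ j ∧ j < n ∧ j < i + n - 1 ∧ ({g i, g j} : Finset V) ∈ Y.faces := by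
    have hy := ZMod.val_lt y
    have h₁' := succ_ne h₁
    have h₂' := succ_ne h₂
    rw [Nat.mod_eq_of_lt (by omega)] at h₁'
    refine ⟨x.val, y.val, by omega, hy, ?_, he⟩
    by_contra hcon
    have hyn : y.val + 1 = n := by omega
    rw [hyn, Nat.mod_self] at h₂'
    omega
  have hcyc : Y.IsCycle n fun x => g x.val := by
    refine ⟨by omega, ?_, ?_⟩
    · intro x y hxy
      apply ZMod.val_injective n
      rcases lt_trichotomy x.val y.val with hlt | heq | hlt
      · exact absurd hxy (hinj _ _ hlt (ZMod.val_lt y))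
      · exact heq
      · exact absurd hxy.symm (hinj _ _ hlt (ZMod.val_lt x))
    · intro x
      have hx := ZMod.val_lt x
      have := hg _ hx
      dsimp only
      rw [val_succ]
      rcases Nat.lt_or_ge (x.val + 1) n with hlt | hge
      · rwa [Nat.mod_eq_of_lt hlt]
      · have hxn : x.val + 1 = n := by omega
        rw [hxn, ← hclosed] at this
        rwa [hxn, Nat.mod_self]
  obtain ⟨x, y, hne, h₁, h₂, he⟩ := hY.2 n _ hcyc hn hnk
  have h₂' : x ≠ y + 1 := fun e => h₂ (by rw [e]; ring)
  rcases lt_trichotomy x.val y.val with hlt | heq | hlt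
  · exact ordered x y hlt h₁ h₂' he
  · exact absurd (ZMod.val_injective n heq).symm hne
  · exact ordered y x hlt h₂' h₁ (by rwa [Finset.pair_comm])

end SComplex

/-- In a covering of a `k`-large complex, closed walks of length less than `k` lift to closed
walks. -/
theorem IsSimplicialCovering.eq_of_isWalk {V W : Type} [DecidableEq V] [DecidableEq W]
    {p : V → W} {X : SComplex V} {Y : SComplex W} (h : IsSimplicialCovering p X Y) {k : ℕ}
    (hY : Y.KLarge k) {n : ℕ} (hnk : n < k) {f : ℕ → V} (hf : X.IsWalk n f)
    (hp : p (f 0) = p (f n)) : f 0 = f n := by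
  induction n using Nat.strong_induction_on generalizing f with
  | _ n ih =>
  by_cases hrep : ∃ i j, i < j ∧ j ≤ n ∧ j < i + n ∧ p (f i) = p (f j)
  · obtain ⟨i, j, hij, hjn, hlt, hpij⟩ := hrep
    have hfij : f i = f j := by
      have := ih (j - i) (by omega) (by omega) (hf.shift (i := i) (by omega))
        (by simpa [Nat.add_sub_of_le hij.le] using hpij)
      simpa [Nat.add_sub_of_le hij.le] using this
    have hskip := hf.skip (i := i) (d := j - i) fun hle => by
      rw [hfij, show i + 1 + (j - i) = j + 1 by omega]
      exact hf j (by omega)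
    have hend : (if n - (j - i) ≤ i then f (n - (j - i)) else f (n - (j - i) + (j - i))) =
        f n := by
      split_ifs with hle
      · obtain rfl : j = n := by omega
        rw [show j - (j - i) = i by omega, hfij]
      · rw [Nat.sub_add_cancel (by omega)]
    have := ih (n - (j - i)) (by omega) (by omega) hskip
      (by rw [hend]; simpa using hp)
    rw [hend] at this
    simpa using this
  · push Not at hrep
    have edge_image : ∀ {a b : V}, ({a, b} : Finset V) ∈ X.faces →
        ({p a, p b} : Finset W) ∈ Y.faces := fun hab => by
      simpa [Finset.image_insert] using (h.1 _ hab).1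
    rcases Nat.lt_or_ge n 4 with hn | hn
    · interval_cases n
      · rfl
      · exact (h.1 _ (hf 0 (by omega))).2 (by simp) (by simp) hp
      · exact h.eq_of_edge (by rw [Finset.pair_comm]; exact hf 0 (by omega))
          (hf 1 (by omega)) hp
      · have e₀ := hf 0 (by omega)
        have e₁ := hf 1 (by omega)
        have e₂ := hf 2 (by omega)
        have i₀ := edge_image e₀
        have i₁ := edge_image e₁
        have i₂ := edge_image e₂
        simp only [zero_add, Nat.reduceAdd] at e₀ e₁ e₂ i₀ i₁ i₂
        rw [← hp] at i₂
        have vert : ∀ {a b : W}, ({a, b} : Finset W) ∈ Y.faces → ({a} : Finset W) ∈ Y.faces :=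
          fun hab => Y.down_closed _ hab _ (by simp) (by simp)
        have ht : ({p (f 1), p (f 0), p (f 2)} : Finset W) ∈ Y.faces := by
          refine hY.1 _ (by simp) ?_ ?_
          · simp only [Finset.mem_insert, Finset.mem_singleton]
            rintro v (rfl | rfl | rfl)
            exacts [vert i₁, vert i₀, vert i₂]
          · simp only [Finset.mem_insert, Finset.mem_singleton]
            rintro v (rfl | rfl | rfl) w (rfl | rfl | rfl) hvw <;>
              first
              | exact absurd rfl hvw
              | assumption
              | (rw [Finset.pair_comm]; assumption)
        have e₃ := h.edge_of_triangle (by rwa [Finset.pair_comm]) e₁ ht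
        exact h.eq_of_edge (by rwa [Finset.pair_comm]) e₂ hp
    · obtain ⟨i, j, hij, hjn, hlt, he⟩ := hY.exists_diagonal (g := fun t => p (f t)) hn hnk
        (fun t ht => edge_image (hf t ht)) hp
        (fun i j hij hj => hrep i j hij hj.le (by omega))
      obtain ⟨w, hw, hpw⟩ := h.exists_lift_edge
        (X.down_closed _ (hf i (by omega)) _ (by simp) (by simp)) he
      have hwj : w = f j := by
        have := ih (j - i + 1) (by omega) (by omega)
          ((hf.shift (i := i) (l := j - i) (by omega)).cons (w := w)
            (by rwa [Finset.pair_comm]))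
          (by simpa [Nat.add_sub_of_le (by omega : i ≤ j)] using hpw)
        simpa [Nat.add_sub_of_le (by omega : i ≤ j)] using this
      have hskip := hf.skip (i := i) (d := j - i - 1) fun _ => by
        rwa [show i + 1 + (j - i - 1) = j by omega, ← hwj]
      have hend : ¬ n - (j - i - 1) ≤ i := by omega
      have hsum : n - (j - i - 1) + (j - i - 1) = n := by omega
      have := ih (n - (j - i - 1)) (by omega) (by omega) hskip
        (by simpa [hend, hsum] using hp)
      simpa [hend, hsum] using this

/-- **Lemma (Osajda, Lemma 2.5).** Let `k ≥ 6`, let `Y` be a `k`-large simplicial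
complex and let `p : X → Y` be the universal cover of `Y`. If `m < (k-1)/2` then for
every `i = 0,...,m` and every simplex `σ` of `X`, the restriction of `p` to the ball
`B_i(σ,X)` is an isomorphism onto its image `p(B_i(σ,X))`. -/
theorem universal_cover_ball_iso {V W : Type} [DecidableEq V] [DecidableEq W]
    (k : ℕ) (hk : 6 ≤ k) (X : SComplex V) (Y : SComplex W) (p : V → W)
    (hY : Y.KLarge k) (hYconn : ConnectedSpace Y.realization)
    (hcov : IsUniversalCover p X Y)
    (m : ℕ) (hm : (m : ℝ) < ((k : ℝ) - 1) / 2) :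
    ∀ i ≤ m, ∀ σ ∈ X.faces,
      Set.InjOn p {v : V | ({v} : Finset V) ∈ X.ballFaces σ i} ∧
      ∀ τ : Finset V, τ.Nonempty →
        (∀ v ∈ τ, ({v} : Finset V) ∈ X.ballFaces σ i) →
        τ.image p ∈ (fun α : Finset V => α.image p) '' (X.ballFaces σ i) →
        τ ∈ X.ballFaces σ i := by
  intro i him σ hσ
  have hik : i + i + 1 < k := by
    have : (2 * m + 1 : ℝ) < k := by linarith
    have : 2 * m + 1 < k := by exact_mod_cast this
    omega
  have hinj : Set.InjOn p {v : V | ({v} : Finset V) ∈ X.ballFaces σ i} := by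
    intro v hv w hw hvw
    obtain ⟨f, hf, hf0, rfl⟩ := SComplex.exists_walk_of_mem_ballFaces hv
    obtain ⟨g, hg, hg0, rfl⟩ := SComplex.exists_walk_of_mem_ballFaces hw
    have hwalk := hf.reverse_append hg
      (X.down_closed _ hσ _ (by simp [Finset.insert_subset_iff, hf0, hg0]) (by simp))
    have hend : ¬ i + i + 1 ≤ i := by omega
    have hsub : i + i + 1 - i - 1 = i := by omega
    simpa [hend, hsub] using
      hcov.1.eq_of_isWalk hY hik hwalk (by simpa [hend, hsub] using hvw)
  refine ⟨hinj, ?_⟩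
  rintro τ - hτ ⟨α, hα, hατ⟩
  have hαv : ∀ v ∈ α, ({v} : Finset V) ∈ X.ballFaces σ i := fun v hv =>
    (X.ball σ i).down_closed α hα _ (by simpa using hv) (by simp)
  have hEq : (p '' (α : Set V)) = p '' (τ : Set V) := by
    simpa only [Finset.coe_image] using congrArg (fun s : Finset W => (s : Set W)) hατ
  rwa [← Finset.coe_injective ((hinj.image_eq_image_iff hαv hτ).mp hEq)]
end

section
/- Let X be a systolic chamber complex of dimension n ≥ 1 and τ a simplex of X. Then for every k ≥ 1 the combinatorial sphere S_k = S_k(τ,X) is an (n−1)-dimensional chamber complex. -/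
universe u

namespace SComplex

section LocalSystem

variable {V : Type u} [DecidableEq V] (X : SComplex V)

/-- The vertex `v` of `X` as a point of the realization. -/
noncomputable def vertexPoint (v : V) (hv : {v} ∈ X.faces) : X.realization :=
  ⟨Pi.single v 1, fun w => by by_cases h : w = v <;> simp [h],
    {v}, hv, fun w hw => by simp_all, by simp⟩

omit [DecidableEq V] in
lemma exists_pos_of_mem_realization (x : X.realization) : ∃ v, 0 < x.1 v := by
  obtain ⟨h0, σ, -, -, hsum⟩ := x.2
  by_contra! h
  have : ∑ v ∈ σ, x.1 v ≤ 0 := Finset.sum_nonpos fun v _ => h v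
  linarith

lemma mem_faces_of_pos (x : X.realization) (A : Finset V) (hA : A.Nonempty)
    (h : ∀ v ∈ A, 0 < x.1 v) : A ∈ X.faces := by
  obtain ⟨-, σ, hσ, hsupp, -⟩ := x.2
  refine X.down_closed σ hσ A (fun v hv => ?_) hA
  by_contra hvσ
  have := h v hv
  rw [hsupp v hvσ] at this
  exact lt_irrefl _ this

lemma pair_mem_of_triple {u v w : V} (h : {u, v, w} ∈ X.faces) :
    {u, v} ∈ X.faces ∧ {v, w} ∈ X.faces ∧ {u, w} ∈ X.faces := by
  refine ⟨X.down_closed _ h _ ?_ (by simp), X.down_closed _ h _ ?_ (by simp),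
    X.down_closed _ h _ ?_ (by simp)⟩ <;> intro a <;> simp <;> tauto

/-- The straight segment between two points of the realization lying in a common simplex. -/
lemma exists_segment {σ : Finset V} (hσ : σ ∈ X.faces) (x y : X.realization)
    (hx : ∀ v ∉ σ, x.1 v = 0) (hy : ∀ v ∉ σ, y.1 v = 0) :
    ∃ γ : Path x y, ∀ t v, 0 < x.1 v → 0 < y.1 v → 0 < (γ t).1 v := by
  have hsum : ∀ z : X.realization, (∀ v ∉ σ, z.1 v = 0) → ∑ v ∈ σ, z.1 v = 1 := by
    intro z hz
    obtain ⟨-, ρ, -, hρ, hs⟩ := z.2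
    have h1 : ∑ v ∈ σ, z.1 v = ∑ v ∈ σ ∪ ρ, z.1 v :=
      Finset.sum_subset Finset.subset_union_left fun v _ h => hz v h
    have h2 : ∑ v ∈ ρ, z.1 v = ∑ v ∈ σ ∪ ρ, z.1 v :=
      Finset.sum_subset Finset.subset_union_right fun v _ h => hρ v h
    rw [h1, ← h2, hs]
  refine ⟨⟨⟨fun t => ⟨fun v => (1 - (t : ℝ)) * x.1 v + t * y.1 v, ?_, σ, hσ, ?_, ?_⟩, ?_⟩,
    ?_, ?_⟩, ?_⟩
  · intro v
    have h0 := t.2.1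
    have h1 := t.2.2
    have := x.2.1 v
    have := y.2.1 v
    have := sub_nonneg.2 h1
    positivity
  · intro v hv
    simp [hx v hv, hy v hv]
  · rw [Finset.sum_add_distrib, ← Finset.mul_sum, ← Finset.mul_sum, hsum x hx, hsum y hy]
    ring
  · refine Continuous.subtype_mk (continuous_pi fun v => ?_) _
    fun_prop
  · ext v; simp
  · ext v; simp
  · intro t v h0 h1
    change 0 < (1 - (t : ℝ)) * x.1 v + t * y.1 v
    have ht0 := t.2.1
    have ht1 := t.2.2
    rcases eq_or_lt_of_le ht0 with h | h
    · rw [← h]; simpa using h0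
    · have := mul_nonneg (sub_nonneg.2 ht1) h0.le
      have := mul_pos h h1
      linarith

/-- A loop-free covering argument: a point of the total space of a covering of a simply
connected space is determined by its projection and its path component. -/
lemma _root_.IsCoveringMap.eq_of_joined {E B : Type*} [TopologicalSpace E] [TopologicalSpace B]
    [SimplyConnectedSpace B] {p : E → B} (cov : IsCoveringMap p) {e₀ e e' : E}
    (h : Joined e₀ e) (h' : Joined e₀ e') (hp : p e = p e') : e = e' := by
  have key : ∀ e : E, Joined e₀ e → ∀ x (_ : p e = x) (γ : Path.Homotopic.Quotient (p e₀) x),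
      (cov.monodromy γ ⟨e₀, rfl⟩ : E) = e := by
    rintro e ⟨Γ⟩ _ rfl γ
    rw [Subsingleton.elim γ ((Path.Homotopic.Quotient.mk Γ).map ⟨p, cov.continuous⟩),
      cov.monodromy_map]
  obtain ⟨γ⟩ := PathConnectedSpace.joined (p e₀) (p e)
  rw [← key e h _ rfl (Path.Homotopic.Quotient.mk γ), key e' h' _ hp.symm]

lemma _root_.IsCoveringMap.exists_joined {E B : Type*} [TopologicalSpace E] [TopologicalSpace B]
    [PathConnectedSpace B] {p : E → B} (cov : IsCoveringMap p) (e₀ : E) (x : B) :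
    ∃ e, Joined e₀ e ∧ p e = x := by
  obtain ⟨γ⟩ := PathConnectedSpace.joined (p e₀) x
  refine ⟨cov.liftPath γ e₀ γ.source 1, ⟨⟨cov.liftPath γ e₀ γ.source, ?_, rfl⟩⟩, ?_⟩
  · exact cov.liftPath_zero ..
  · exact (congrFun (cov.liftPath_lifts γ e₀ γ.source) 1).trans γ.target

/-- The bundle over the realization associated to a simplicial local system. -/
noncomputable def localSystemBundle {F : Type*} [TopologicalSpace F] [DiscreteTopology F]
    (g : V → V → F → F) (hid : ∀ v, {v} ∈ X.faces → ∀ f, g v v f = f)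
    (hcomp : ∀ u v w, {u, v, w} ∈ X.faces → ∀ f, g v w (g u v f) = g u w f) :
    FiberBundleCore V X.realization F where
  baseSet v := {x | 0 < x.1 v}
  isOpen_baseSet v := isOpen_lt continuous_const ((continuous_apply v).comp continuous_subtype_val)
  indexAt x := (X.exists_pos_of_mem_realization x).choose
  mem_baseSet_at x := (X.exists_pos_of_mem_realization x).choose_spec
  coordChange i j _ := g i j
  coordChange_self i x hx := hid i (X.mem_faces_of_pos x _ (by simp) (by simpa using hx))
  continuousOn_coordChange i j :=
    ((continuous_of_discreteTopology (f := g i j)).comp continuous_snd).continuousOn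
  coordChange_comp i j k x hx :=
    hcomp i j k (X.mem_faces_of_pos x _ (by simp) (by
      intro v hv
      simp only [Finset.mem_insert, Finset.mem_singleton] at hv
      obtain ⟨⟨h1, h2⟩, h3⟩ := hx
      rcases hv with rfl | rfl | rfl <;> assumption))

/-- A simplicial local system on a complex with simply connected realization has a global
section through every point of every fibre. -/
theorem exists_section_of_localSystem [SimplyConnectedSpace X.realization] {F : Type*}
    (g : V → V → F → F) (hid : ∀ v, {v} ∈ X.faces → ∀ f, g v v f = f)
    (hcomp : ∀ u v w, {u, v, w} ∈ X.faces → ∀ f, g v w (g u v f) = g u w f)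
    (v₀ : V) (hv₀ : {v₀} ∈ X.faces) (f₀ : F) :
    ∃ h : V → F, h v₀ = f₀ ∧ ∀ u v, {u, v} ∈ X.faces → g u v (h u) = h v := by
  classical
  let _ : TopologicalSpace F := ⊥
  have : DiscreteTopology F := ⟨rfl⟩
  let Z := X.localSystemBundle g hid hcomp
  have cov : IsCoveringMap Z.proj := FiberBundle.isCoveringMap
  have hinj : ∀ x c d, (⟨x, c⟩ : Z.TotalSpace) = ⟨x, d⟩ → c = d := fun x c d h => by
    cases h; rfl
  have hdeg : ∀ u v, {u, v} ∈ X.faces → {u} ∈ X.faces ∧ {v} ∈ X.faces := fun u v h =>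
    ⟨X.down_closed _ h _ (by simp) (by simp), X.down_closed _ h _ (by simp) (by simp)⟩
  have hjoin : ∀ (i : V) (σ : Finset V) (_ : σ ∈ X.faces) (x y : X.realization),
      (∀ v ∉ σ, x.1 v = 0) → (∀ v ∉ σ, y.1 v = 0) → 0 < x.1 i → 0 < y.1 i → ∀ c : F,
      Joined (⟨x, g i (Z.indexAt x) c⟩ : Z.TotalSpace) ⟨y, g i (Z.indexAt y) c⟩ := by
    intro i σ hσ x y hx hy hxi hyi c
    obtain ⟨γ, hγ⟩ := X.exists_segment hσ x y hx hy
    refine ⟨⟨⟨fun t => (Z.localTriv i).toOpenPartialHomeomorph.symm (γ t, c), ?_⟩, ?_, ?_⟩⟩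
    · refine (Z.localTriv i).toOpenPartialHomeomorph.continuousOn_symm.comp_continuous
        (by fun_prop) fun t => ?_
      exact (Z.localTriv i).mem_target.2 (hγ t i hxi hyi)
    · change (Z.localTriv i).toOpenPartialHomeomorph.symm (γ 0, c) = _
      rw [γ.source]; rfl
    · change (Z.localTriv i).toOpenPartialHomeomorph.symm (γ 1, c) = _
      rw [γ.target]; rfl
  have hidx : ∀ (x : X.realization) (v w : V), 0 < x.1 v → 0 < x.1 w → ∀ c,
      g (Z.indexAt x) w (g v (Z.indexAt x) c) = g v w c := fun x v w hv hw c =>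
    Z.coordChange_comp v (Z.indexAt x) w x ⟨⟨hv, Z.mem_baseSet_at x⟩, hw⟩ c
  have hpt : ∀ v hv, 0 < (X.vertexPoint v hv).1 v := fun v hv => by simp [vertexPoint]
  let e₀ : Z.TotalSpace := ⟨X.vertexPoint v₀ hv₀, g v₀ (Z.indexAt (X.vertexPoint v₀ hv₀)) f₀⟩
  have hex : ∀ v (hv : {v} ∈ X.faces), ∃ c : F,
      Joined e₀ ⟨X.vertexPoint v hv, g v (Z.indexAt (X.vertexPoint v hv)) c⟩ := by
    intro v hv
    obtain ⟨⟨x, c⟩, hj, hx⟩ := cov.exists_joined e₀ (X.vertexPoint v hv)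
    obtain rfl : x = _ := hx
    refine ⟨g (Z.indexAt (X.vertexPoint v hv)) v c, ?_⟩
    convert hj
    have := Z.coordChange_comp (Z.indexAt (X.vertexPoint v hv)) v
      (Z.indexAt (X.vertexPoint v hv)) (X.vertexPoint v hv)
      ⟨⟨Z.mem_baseSet_at _, hpt v hv⟩, Z.mem_baseSet_at _⟩ c
    exact congrArg (Bundle.TotalSpace.mk (F := F) (E := Z.Fiber) _)
      (this.trans (Z.coordChange_self _ _ (Z.mem_baseSet_at _) _))
  choose c hc using hex
  refine ⟨fun v => if hv : {v} ∈ X.faces then c v hv else f₀, ?_, ?_⟩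
  · have := cov.eq_of_joined (hc v₀ hv₀) (Joined.refl e₀) rfl
    have h2 : g v₀ (Z.indexAt (X.vertexPoint v₀ hv₀)) (c v₀ hv₀)
        = g v₀ (Z.indexAt (X.vertexPoint v₀ hv₀)) f₀ :=
      hinj _ _ _ this
    have h3 := congrArg (g (Z.indexAt (X.vertexPoint v₀ hv₀)) v₀) h2
    rw [hidx _ _ _ (hpt _ _) (hpt _ _), hidx _ _ _ (hpt _ _) (hpt _ _), hid _ hv₀,
      hid _ hv₀] at h3
    simp [hv₀, h3]
  · intro u v huv
    obtain ⟨hu, hv⟩ := hdeg u v huv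
    simp only [hu, hv, dite_true]
    have hmp : ∃ m : X.realization, 0 < m.1 u ∧ 0 < m.1 v ∧
        ∀ w ∉ ({u, v} : Finset V), m.1 w = 0 := by
      by_cases h : u = v
      · subst h
        exact ⟨X.vertexPoint u hu, hpt _ _, hpt _ _, fun w hw => by
          simp_all [vertexPoint]⟩
      · refine ⟨⟨Pi.single u (1 / 2) + Pi.single v (1 / 2), ?_, {u, v}, huv, ?_, ?_⟩, ?_, ?_, ?_⟩
        · intro w
          have h1 : (0 : V → ℝ) ≤ Pi.single u (1 / 2) := Pi.single_nonneg.2 (by norm_num)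
          have h2 : (0 : V → ℝ) ≤ Pi.single v (1 / 2) := Pi.single_nonneg.2 (by norm_num)
          exact add_nonneg (h1 w) (h2 w)
        · intro w hw
          simp only [Finset.mem_insert, Finset.mem_singleton, not_or] at hw
          simp [hw]
        · rw [Finset.sum_pair h]
          simp [h, Ne.symm h]
          norm_num
        · simp [h]
        · simp [Ne.symm h]
        · intro w hw
          simp only [Finset.mem_insert, Finset.mem_singleton, not_or] at hw
          simp [hw]
    obtain ⟨m, hmu, hmv, hm⟩ := hmp
    have hsup : ∀ w hw, w ∈ ({u, v} : Finset V) →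
        ∀ z ∉ ({u, v} : Finset V), (X.vertexPoint w hw).1 z = 0 := by
      intro w hw hwm z hz
      have : z ≠ w := fun h => hz (h ▸ hwm)
      simp [vertexPoint, this]
    have h1 := (hc u hu).trans (hjoin u _ huv _ m (hsup u hu (by simp)) hm (hpt _ _) hmu _)
    have h2 := (hc v hv).trans (hjoin v _ huv _ m (hsup v hv (by simp)) hm (hpt _ _) hmv _)
    have h3 : g u (Z.indexAt m) (c u hu) = g v (Z.indexAt m) (c v hv) :=
      hinj _ _ _ (cov.eq_of_joined h1 h2 rfl)
    have h4 := congrArg (g (Z.indexAt m) v) h3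
    rwa [hidx m _ _ hmu hmv, hidx m _ _ hmv hmv, hid _ hv] at h4

end LocalSystem

section Local

variable {V : Type u} [DecidableEq V] {X : SComplex V}

/-- Three distinct vertices spanning a simplex of `X`. -/
structure Tri (X : SComplex V) (a b c : V) : Prop where
  ne₁₂ : a ≠ b
  ne₂₃ : b ≠ c
  ne₁₃ : a ≠ c
  mem : {a, b, c} ∈ X.faces

/-- Two distinct vertices spanning a simplex of `X`. -/
structure Edge (X : SComplex V) (a b : V) : Prop where
  ne : a ≠ b
  mem : {a, b} ∈ X.faces

lemma Edge.symm {a b : V} (h : X.Edge a b) : X.Edge b a :=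
  ⟨h.ne.symm, Finset.pair_comm a b ▸ h.mem⟩

namespace Tri

variable {a b c d e v : V}

lemma acb (h : X.Tri a b c) : X.Tri a c b :=
  ⟨h.ne₁₃, h.ne₂₃.symm, h.ne₁₂, Finset.pair_comm b c ▸ h.mem⟩

lemma bac (h : X.Tri a b c) : X.Tri b a c :=
  ⟨h.ne₁₂.symm, h.ne₁₃, h.ne₂₃, Finset.insert_comm a b {c} ▸ h.mem⟩

lemma bca (h : X.Tri a b c) : X.Tri b c a := h.bac.acb

lemma cab (h : X.Tri a b c) : X.Tri c a b := h.acb.bac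

lemma cba (h : X.Tri a b c) : X.Tri c b a := h.bca.bac

lemma edge₁₂ (h : X.Tri a b c) : X.Edge a b := ⟨h.ne₁₂, (X.pair_mem_of_triple h.mem).1⟩

lemma edge₂₃ (h : X.Tri a b c) : X.Edge b c := ⟨h.ne₂₃, (X.pair_mem_of_triple h.mem).2.1⟩

lemma edge₁₃ (h : X.Tri a b c) : X.Edge a c := ⟨h.ne₁₃, (X.pair_mem_of_triple h.mem).2.2⟩

lemma vertex (h : X.Tri a b c) : {a} ∈ X.faces :=
  X.down_closed _ h.mem _ (by simp) (by simp)

lemma mem_link_iff : {a, b} ∈ (X.link {v}).faces ∧ a ≠ b ↔ X.Tri v a b := by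
  constructor
  · rintro ⟨⟨-, h2, h3⟩, hne⟩
    simp only [Finset.disjoint_singleton_right, Finset.mem_insert, Finset.mem_singleton,
      not_or] at h2
    refine ⟨h2.1, hne, h2.2, ?_⟩
    convert h3 using 1
    ext; simp; tauto
  · intro h
    refine ⟨⟨h.edge₂₃.mem, by simp [h.ne₁₂, h.ne₁₃], ?_⟩, h.ne₂₃⟩
    convert h.mem using 1
    ext; simp; tauto

/-- In a locally `6`-large complex, links of vertices contain no empty triangles. -/
lemma tet (hX : X.LocallyKLarge 6) (hab : X.Tri v a b) (hbc : X.Tri v b c)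
    (hac : X.Tri v a c) : X.Tri a b c := by
  refine ⟨hab.ne₂₃, hbc.ne₂₃, hac.ne₂₃, ?_⟩
  have hf := (hX {v} hab.vertex).1 {a, b, c} (by simp) (by
    have h1 := X.link {v} |>.down_closed _ (mem_link_iff.2 hab).1
    have h2 := X.link {v} |>.down_closed _ (mem_link_iff.2 hbc).1
    intro w hw
    simp only [Finset.mem_insert, Finset.mem_singleton] at hw
    rcases hw with rfl | rfl | rfl
    · exact h1 _ (by simp) (by simp)
    · exact h1 _ (by simp) (by simp)
    · exact h2 _ (by simp) (by simp)) (by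
    intro w hw w' hw' hne
    simp only [Finset.mem_insert, Finset.mem_singleton] at hw hw'
    refine (mem_link_iff.2 (?_ : X.Tri v w w')).1
    have := hab.acb
    have := hbc.acb
    have := hac.acb
    rcases hw with rfl | rfl | rfl <;> rcases hw' with rfl | rfl | rfl <;>
      first | assumption | exact absurd rfl hne)
  exact hf.1

/-- In a locally `6`-large complex, every `4`-cycle in the link of a vertex has a diagonal. -/
lemma sq (hX : X.LocallyKLarge 6) (hab : X.Tri v a b) (hbc : X.Tri v b c)
    (hcd : X.Tri v c d) (hda : X.Tri v d a) (hac : a ≠ c) (hbd : b ≠ d) :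
    X.Tri v a c ∨ X.Tri v b d := by
  have h1 := hab.ne₂₃
  have h2 := hbc.ne₂₃
  have h3 := hcd.ne₂₃
  have h4 := hda.ne₂₃
  let γ : ZMod 4 → V := ![a, b, c, d]
  have hinj : Function.Injective γ := by
    intro i j h
    change Fin 4 at i j
    fin_cases i <;> fin_cases j <;> first | rfl | simp_all [γ]
  obtain ⟨i, j, h1, h2, h3, h⟩ := (hX {v} hab.vertex).2 4 γ ⟨by norm_num, hinj, by
    intro i
    change Fin 4 at i
    fin_cases i
    · exact (mem_link_iff.2 hab).1
    · exact (mem_link_iff.2 hbc).1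
    · exact (mem_link_iff.2 hcd).1
    · exact (mem_link_iff.2 hda).1⟩ le_rfl (by norm_num)
  have ht := mem_link_iff.1 ⟨h, fun h => h1 (hinj h).symm⟩
  have ht' := ht.acb
  change Fin 4 at i j
  fin_cases i <;> fin_cases j <;>
    first
    | exact absurd rfl h1
    | exact absurd rfl h2
    | exact absurd rfl h3
    | exact Or.inl ht
    | exact Or.inl ht'
    | exact Or.inr ht
    | exact Or.inr ht'

/-- In a locally `6`-large complex, every `5`-cycle in the link of a vertex has a diagonal. -/
lemma pent (hX : X.LocallyKLarge 6) (hab : X.Tri v a b) (hbc : X.Tri v b c)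
    (hcd : X.Tri v c d) (hde : X.Tri v d e) (hea : X.Tri v e a) (hac : a ≠ c) (had : a ≠ d)
    (hbd : b ≠ d) (hbe : b ≠ e) (hce : c ≠ e) :
    X.Tri v a c ∨ X.Tri v a d ∨ X.Tri v b d ∨ X.Tri v b e ∨ X.Tri v c e := by
  have h1 := hab.ne₂₃
  have h2 := hbc.ne₂₃
  have h3 := hcd.ne₂₃
  have h4 := hde.ne₂₃
  have h5 := hea.ne₂₃
  let γ : ZMod 5 → V := ![a, b, c, d, e]
  have hinj : Function.Injective γ := by
    intro i j h
    change Fin 5 at i j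
    fin_cases i <;> fin_cases j <;> first | rfl | simp_all [γ]
  obtain ⟨i, j, h1, h2, h3, h⟩ := (hX {v} hab.vertex).2 5 γ ⟨by norm_num, hinj, by
    intro i
    change Fin 5 at i
    fin_cases i
    · exact (mem_link_iff.2 hab).1
    · exact (mem_link_iff.2 hbc).1
    · exact (mem_link_iff.2 hcd).1
    · exact (mem_link_iff.2 hde).1
    · exact (mem_link_iff.2 hea).1⟩ (by norm_num) (by norm_num)
  have ht := mem_link_iff.1 ⟨h, fun h => h1 (hinj h).symm⟩
  have ht' := ht.acb
  change Fin 5 at i j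
  fin_cases i <;> fin_cases j <;>
    first
    | exact absurd rfl h1
    | exact absurd rfl h2
    | exact absurd rfl h3
    | exact Or.inl ht
    | exact Or.inl ht'
    | exact Or.inr (Or.inl ht)
    | exact Or.inr (Or.inl ht')
    | exact Or.inr (Or.inr (Or.inl ht))
    | exact Or.inr (Or.inr (Or.inl ht'))
    | exact Or.inr (Or.inr (Or.inr (Or.inl ht)))
    | exact Or.inr (Or.inr (Or.inr (Or.inl ht')))
    | exact Or.inr (Or.inr (Or.inr (Or.inr ht)))
    | exact Or.inr (Or.inr (Or.inr (Or.inr ht')))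

end Tri

end Local

/-- A sphere in the development of a locally `6`-large complex `X`: its vertices, their
projections to `X`, adjacency within the sphere, and the projections of the neighbours of a
vertex in the previous sphere, subject to the local conditions that make it possible to
construct the next sphere. -/
structure Layer {V : Type u} [DecidableEq V] (X : SComplex V) where
  T : Type u
  p : T → V
  vertex : ∀ w, {p w} ∈ X.faces
  adj : T → T → Prop
  par : T → Set V
  adj_symm : ∀ {w w'}, adj w w' → adj w' w
  adj_edge : ∀ {w w'}, adj w w' → X.Edge (p w) (p w')
  par_edge : ∀ {w y}, y ∈ par w → X.Edge y (p w)
  adj_inj : ∀ {w w₁ w₂}, adj w w₁ → adj w w₂ → p w₁ = p w₂ → w₁ = w₂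
  adj_notMem_par : ∀ {w w₁}, adj w w₁ → p w₁ ∉ par w
  child_not_tri : ∀ {w y z}, y ∈ par w → X.Tri y (p w) z → z ∉ par w →
    (∀ w', adj w w' → p w' ≠ z) → False
  adj_of_tri : ∀ {w w₁ w₂}, adj w w₁ → adj w w₂ → X.Tri (p w) (p w₁) (p w₂) → adj w₁ w₂
  par_of_tri : ∀ {w w₁ y}, adj w w₁ → y ∈ par w → X.Tri y (p w) (p w₁) → y ∈ par w₁
  tri_of_child : ∀ {w w₁ w₂ z}, adj w w₁ → adj w w₂ → w₁ ≠ w₂ → z ∉ par w →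
    (∀ w', adj w w' → p w' ≠ z) → X.Tri z (p w) (p w₁) → X.Tri z (p w) (p w₂) →
    X.Tri (p w) (p w₁) (p w₂)

namespace Layer

variable {V : Type u} [DecidableEq V] {X : SComplex V} (L : Layer X)

/-- The edge from `L.p w` to `z` leads from `w` to the next sphere. -/
structure Child (w : L.T) (z : V) : Prop where
  edge : X.Edge (L.p w) z
  notMem_par : z ∉ L.par w
  ne : ∀ w', L.adj w w' → L.p w' ≠ z

variable {L}

lemma Child.transfer {w w' : L.T} {z : V} (h : L.Child w z) (ha : L.adj w w')
    (ht : X.Tri z (L.p w) (L.p w')) : L.Child w' z where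
  edge := ht.acb.edge₁₂.symm
  notMem_par hz := h.notMem_par (L.par_of_tri (L.adj_symm ha) hz ht.acb)
  ne w₃ h₃ hz := by
    subst hz
    exact h.ne w₃ (L.adj_of_tri (L.adj_symm ha) h₃ ht.cba) rfl

variable (L) in
/-- Two outgoing edges lead to the same vertex of the next sphere. -/
def Rel (w w' : L.T) (z : V) : Prop := w = w' ∨ L.adj w w' ∧ X.Tri z (L.p w) (L.p w')

lemma Rel.symm {w w' : L.T} {z : V} (h : L.Rel w w' z) : L.Rel w' w z := by
  rcases h with rfl | ⟨h, ht⟩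
  · exact Or.inl rfl
  · exact Or.inr ⟨L.adj_symm h, ht.acb⟩

lemma Rel.trans (hX : X.LocallyKLarge 6) {w w₁ w₂ : L.T} {z : V} (hc : L.Child w z)
    (h₁ : L.Rel w w₁ z) (h₂ : L.Rel w w₂ z) : L.Rel w₁ w₂ z := by
  rcases h₁ with rfl | ⟨h₁, t₁⟩
  · exact h₂
  rcases h₂ with rfl | ⟨h₂, t₂⟩
  · exact Or.inr ⟨L.adj_symm h₁, t₁.acb⟩
  by_cases hne : w₁ = w₂
  · exact Or.inl hne
  have t := L.tri_of_child h₁ h₂ hne hc.notMem_par hc.ne t₁ t₂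
  exact Or.inr ⟨L.adj_of_tri h₁ h₂ t, Tri.tet hX t₁.bac t t₂.bac⟩

variable (L) in
/-- The identification of outgoing edges leading to the same vertex of the next sphere. -/
def childSetoid (hX : X.LocallyKLarge 6) : Setoid {q : L.T × V // L.Child q.1 q.2} where
  r q q' := q.1.2 = q'.1.2 ∧ L.Rel q.1.1 q'.1.1 q.1.2
  iseqv :=
    { refl := fun q => ⟨rfl, Or.inl rfl⟩
      symm := fun {q q'} h => ⟨h.1.symm, h.1 ▸ h.2.symm⟩
      trans := by
        rintro ⟨⟨w, z⟩, h⟩ ⟨⟨w', z'⟩, h'⟩ ⟨⟨w'', z''⟩, h''⟩ ⟨h1, h2⟩ ⟨h3, h4⟩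
        dsimp only at *
        subst h1 h3
        exact ⟨rfl, Rel.trans hX h' h2.symm h4⟩ }

variable (L) in
/-- The vertices of the next sphere. -/
def Next (hX : X.LocallyKLarge 6) : Type u := Quotient (L.childSetoid hX)

namespace Next

variable {hX : X.LocallyKLarge 6}

/-- The endpoint of an outgoing edge. -/
def mk (hX : X.LocallyKLarge 6) (w : L.T) (z : V) (h : L.Child w z) : L.Next hX :=
  Quotient.mk (L.childSetoid hX) ⟨(w, z), h⟩

/-- The projection of the next sphere to `X`. -/
def proj : L.Next hX → V := Quotient.lift (fun q => q.1.2) fun _ _ h => h.1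

@[simp] lemma proj_mk (w : L.T) (z : V) (h : L.Child w z) : (mk hX w z h).proj = z := rfl

lemma mk_eq_mk {w w' : L.T} {z : V} {h : L.Child w z} {h' : L.Child w' z} :
    mk hX w z h = mk hX w' z h' ↔ L.Rel w w' z :=
  Quotient.eq.trans ⟨fun h => h.2, fun h => ⟨rfl, h⟩⟩

lemma exists_mk (α : L.Next hX) : ∃ w z h, α = mk hX w z h := by
  obtain ⟨⟨⟨w, z⟩, h⟩, rfl⟩ := Quotient.exists_rep α
  exact ⟨w, z, h, rfl⟩

/-- `α` is the endpoint of an edge starting at `w`. -/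
def IsParent (w : L.T) (α : L.Next hX) : Prop := ∃ h, α = mk hX w α.proj h

lemma isParent_mk {w : L.T} {z : V} (h : L.Child w z) : IsParent w (mk hX w z h) := ⟨h, rfl⟩

lemma IsParent.child {w : L.T} {α : L.Next hX} (h : IsParent w α) : L.Child w α.proj := h.1

lemma IsParent.eq {w : L.T} {α β : L.Next hX} (hα : IsParent w α) (hβ : IsParent w β)
    (h : α.proj = β.proj) : α = β := by
  obtain ⟨h1, e1⟩ := hα
  obtain ⟨h2, e2⟩ := hβ
  rw [e1, e2]
  congr

lemma IsParent.rel {w w' : L.T} {α : L.Next hX} (h : IsParent w α) (h' : IsParent w' α) :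
    L.Rel w w' α.proj := by
  obtain ⟨h1, e1⟩ := h
  obtain ⟨h2, e2⟩ := h'
  exact mk_eq_mk.1 (e1.symm.trans e2)

lemma IsParent.inj {w w' : L.T} {α : L.Next hX} (h : IsParent w α) (h' : IsParent w' α)
    (hp : L.p w = L.p w') : w = w' :=
  (h.rel h').resolve_right fun h => h.2.ne₂₃ hp

lemma IsParent.transfer {w w' : L.T} {α : L.Next hX} (h : IsParent w α) (ha : L.adj w w')
    (ht : X.Tri α.proj (L.p w) (L.p w')) : IsParent w' α := by
  obtain ⟨h1, e1⟩ := h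
  exact ⟨h1.transfer ha ht, e1.trans (mk_eq_mk.2 (Or.inr ⟨ha, ht⟩))⟩

/-- Adjacency in the next sphere. -/
def Adj (α β : L.Next hX) : Prop :=
  ∃ w, IsParent w α ∧ IsParent w β ∧ X.Tri (L.p w) α.proj β.proj

lemma Adj.symm {α β : L.Next hX} : Adj α β → Adj β α := fun ⟨w, h1, h2, h3⟩ => ⟨w, h2, h1, h3.acb⟩

/-- The projections of the parents of a vertex of the next sphere. -/
def par (α : L.Next hX) : Set V := {y | ∃ w, IsParent w α ∧ L.p w = y}

lemma Adj.isParent {w : L.T} {α β : L.Next hX} (h : Adj α β) (hw : IsParent w α)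
    (ht : X.Tri (L.p w) α.proj β.proj) : IsParent w β := by
  obtain ⟨w₁, h1, h2, h3⟩ := h
  rcases h1.rel hw with rfl | ⟨ha, t⟩
  · exact h2
  · exact h2.transfer ha (Tri.tet hX h3.bac ht.bca t).bac

lemma Adj.proj_notMem_par {α β : L.Next hX} (h : Adj α β) : β.proj ∉ par α := by
  rintro ⟨w', hw', hp⟩
  obtain ⟨w, h1, h2, h3⟩ := h
  rcases h1.rel hw' with rfl | ⟨ha, t⟩
  · exact h2.child.edge.ne hp
  · exact h2.child.ne w' ha hp

lemma Adj.inj {α β γ : L.Next hX} (h : Adj α β) (h' : Adj α γ) (hp : β.proj = γ.proj) :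
    β = γ := by
  obtain ⟨w, h1, h2, h3⟩ := h'
  exact (h.isParent h1 (hp ▸ h3)).eq h2 hp

lemma Adj.of_tri {α β γ : L.Next hX} (h : Adj α β) (h' : Adj α γ)
    (ht : X.Tri α.proj β.proj γ.proj) : Adj β γ := by
  have key : ∀ w, IsParent w α → IsParent w β → X.Tri (L.p w) α.proj β.proj →
      X.Tri (L.p w) α.proj γ.proj → Adj β γ := fun w hα hβ t t' =>
    ⟨w, hβ, h'.isParent hα t', Tri.tet hX t.bac ht t'.bac⟩
  obtain ⟨w₁, h1, h2, t1⟩ := h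
  obtain ⟨w₂, h3, h4, t2⟩ := h'
  rcases h1.rel h3 with rfl | ⟨ha, t⟩
  · exact key w₁ h1 h2 t1 t2
  have n1 : β.proj ≠ L.p w₂ := fun e =>
    Adj.proj_notMem_par ⟨w₁, h1, h2, t1⟩ ⟨w₂, h3, e.symm⟩
  have n2 : L.p w₁ ≠ γ.proj := fun e =>
    Adj.proj_notMem_par ⟨w₂, h3, h4, t2⟩ ⟨w₁, h1, e⟩
  rcases Tri.sq hX t1.bca t t2.bac ht.acb n1 n2 with s | s
  · exact key w₂ h3 (Adj.isParent ⟨w₁, h1, h2, t1⟩ h3 s.cab) s.cab t2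
  · exact key w₁ h1 h2 t1 s.bac

lemma not_tri_of_forall_ne {α : L.Next hX} {y z : V} (hy : y ∈ par α) (ht : X.Tri y α.proj z)
    (hz : z ∉ par α) (hne : ∀ β, Adj α β → β.proj ≠ z) : False := by
  obtain ⟨w, hw, rfl⟩ := hy
  by_cases hc : L.Child w z
  · exact hne (mk hX w z hc) ⟨w, hw, isParent_mk hc, ht⟩ rfl
  by_cases hp : z ∈ L.par w
  · exact L.child_not_tri hp ht.cab hw.child.notMem_par hw.child.ne
  by_cases ha : ∃ w', L.adj w w' ∧ L.p w' = z
  · obtain ⟨w', ha, rfl⟩ := ha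
    exact hz ⟨w', hw.transfer ha ht.bac, rfl⟩
  · push Not at ha
    exact hc ⟨ht.edge₁₃, hp, ha⟩

lemma Adj.tri_of_forall_ne {α β γ : L.Next hX} {z : V} (h : Adj α β) (h' : Adj α γ)
    (hne : β ≠ γ) (hz : z ∉ par α) (hz' : ∀ δ, Adj α δ → δ.proj ≠ z)
    (tβ : X.Tri z α.proj β.proj) (tγ : X.Tri z α.proj γ.proj) :
    X.Tri α.proj β.proj γ.proj := by
  have hnp : β.proj ≠ γ.proj := fun e => hne (h.inj h' e)
  have hn : ∀ w, IsParent w α → ¬ X.Tri α.proj z (L.p w) := fun w hw t =>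
    not_tri_of_forall_ne ⟨w, hw, rfl⟩ t.cab hz hz'
  have hnz : ∀ w, IsParent w α → z ≠ L.p w := fun w hw e => hz ⟨w, hw, e.symm⟩
  have key : ∀ w, IsParent w α → X.Tri (L.p w) α.proj β.proj → X.Tri (L.p w) α.proj γ.proj →
      X.Tri α.proj β.proj γ.proj := fun w hw t t' =>
    (Tri.sq hX tβ.bac t.bca t'.bac tγ.bca (hnz w hw) hnp).resolve_left (hn w hw)
  obtain ⟨w₁, h1, h2, t1⟩ := id h
  obtain ⟨w₂, h3, h4, t2⟩ := id h'
  rcases h1.rel h3 with rfl | ⟨ha, t⟩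
  · exact key w₁ h1 t1 t2
  have n1 : β.proj ≠ L.p w₂ := fun e => h.proj_notMem_par ⟨w₂, h3, e.symm⟩
  have n2 : L.p w₁ ≠ γ.proj := fun e => h'.proj_notMem_par ⟨w₁, h1, e⟩
  rcases Tri.pent hX tβ.bac t1.bca t t2.bac tγ.bca (hnz w₁ h1) (hnz w₂ h3) n1 hnp n2 with
    s | s | s | s | s
  · exact absurd s (hn w₁ h1)
  · exact absurd s (hn w₂ h3)
  · exact key w₂ h3 s.cab t2
  · exact s
  · exact key w₁ h1 t1 s.bac

end Next

/-- The next sphere of the development. -/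
def next (hX : X.LocallyKLarge 6) (L : Layer X) : Layer X where
  T := L.Next hX
  p := Next.proj
  vertex α := by
    obtain ⟨w, z, h, rfl⟩ := α.exists_mk
    exact X.down_closed _ h.edge.mem _ (by simp) (by simp)
  adj := Next.Adj
  par := Next.par
  adj_symm := Next.Adj.symm
  adj_edge := fun ⟨_, _, _, t⟩ => t.edge₂₃
  par_edge := by
    rintro α _ ⟨w, hw, rfl⟩
    exact hw.child.edge
  adj_inj := Next.Adj.inj
  adj_notMem_par := Next.Adj.proj_notMem_par
  child_not_tri := Next.not_tri_of_forall_ne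
  adj_of_tri := Next.Adj.of_tri
  par_of_tri := by
    rintro α β _ h ⟨w, hw, rfl⟩ t
    exact ⟨w, h.isParent hw t, rfl⟩
  tri_of_child := Next.Adj.tri_of_forall_ne

/-- The simplex `τ` as the sphere of radius `0`. -/
def base (τ : Finset V) (hτ : τ ∈ X.faces) : Layer X where
  T := {v // v ∈ τ}
  p := Subtype.val
  vertex w := X.down_closed _ hτ _ (by simp [w.2]) (by simp)
  adj := (· ≠ ·)
  par _ := ∅
  adj_symm := Ne.symm
  adj_edge {w w'} h := ⟨fun e => h (Subtype.ext e),
    X.down_closed _ hτ _ (by simp [Finset.insert_subset_iff, w.2, w'.2]) (by simp)⟩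
  par_edge h := absurd h (Set.notMem_empty _)
  adj_inj _ _ h := Subtype.ext h
  adj_notMem_par _ := Set.notMem_empty _
  child_not_tri h := absurd h (Set.notMem_empty _)
  adj_of_tri _ _ t e := t.ne₂₃ (congrArg _ e)
  par_of_tri _ h := absurd h (Set.notMem_empty _)
  tri_of_child {w w₁ w₂ z} h₁ h₂ h _ _ _ _ :=
    ⟨fun e => h₁ (Subtype.ext e), fun e => h (Subtype.ext e), fun e => h₂ (Subtype.ext e),
      X.down_closed _ hτ _ (by simp [Finset.insert_subset_iff, w.2, w₁.2, w₂.2]) (by simp)⟩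

end Layer

section Section

variable {V : Type u} [DecidableEq V] {X : SComplex V}

/-- A property of vertices that spreads along edges holds everywhere in a connected complex. -/
lemma forall_vertex_of_connected [ConnectedSpace X.realization] (P : V → Prop)
    (hP : ∀ u v, {u, v} ∈ X.faces → P u → P v) {v₀ : V} (hv₀ : {v₀} ∈ X.faces) (h₀ : P v₀) {v : V}
    (hv : {v} ∈ X.faces) : P v := by
  have hopen : ∀ Q : V → Prop, IsOpen {x : X.realization | ∃ v, Q v ∧ 0 < x.1 v} := by
    intro Q
    have : {x : X.realization | ∃ v, Q v ∧ 0 < x.1 v} =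
        ⋃ v, ⋃ _ : Q v, {x : X.realization | 0 < x.1 v} := by ext; simp
    rw [this]
    refine isOpen_iUnion fun v => isOpen_iUnion fun _ => ?_
    exact isOpen_lt continuous_const ((continuous_apply v).comp continuous_subtype_val)
  have hclopen : IsClopen {x : X.realization | ∃ v, P v ∧ 0 < x.1 v} := by
    refine ⟨⟨?_⟩, hopen P⟩
    convert hopen fun v => ¬ P v using 1
    ext x
    simp only [Set.mem_compl_iff, Set.mem_ofPred_eq, not_exists, not_and]
    constructor
    · intro h
      obtain ⟨w, hw⟩ := X.exists_pos_of_mem_realization x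
      exact ⟨w, fun hp => h w hp hw, hw⟩
    · rintro ⟨w, hw, hwx⟩ w' hw' hwx'
      exact hw (hP w' w (X.mem_faces_of_pos x _ (by simp) (by simp [hwx, hwx'])) hw')
  have huniv := hclopen.eq_univ ⟨X.vertexPoint v₀ hv₀, v₀, h₀, by simp [vertexPoint]⟩
  obtain ⟨w, hw, hwv⟩ := huniv.ge (Set.mem_univ (X.vertexPoint v hv))
  by_cases h : w = v
  · exact h ▸ hw
  · simp [vertexPoint, h] at hwv

/-- A simplicial covering of a simply connected complex has a section through every vertex. -/
theorem exists_section_of_covering [ConnectedSpace X.realization]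
    [SimplyConnectedSpace X.realization] {Y : Type*} (p : Y → V) (N : Y → Y → Prop)
    (hsymm : ∀ y y', N y y' → N y' y) (hedge : ∀ y y', N y y' → X.Edge (p y) (p y'))
    (hlift : ∀ y v, X.Edge (p y) v → ∃ y', N y y' ∧ p y' = v)
    (huniq : ∀ y y₁ y₂, N y y₁ → N y y₂ → p y₁ = p y₂ → y₁ = y₂)
    (htri : ∀ y y₁ y₂, N y y₁ → N y y₂ → X.Tri (p y) (p y₁) (p y₂) → N y₁ y₂)
    (y₀ : Y) (hy₀ : {p y₀} ∈ X.faces) :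
    ∃ h : V → Y, h (p y₀) = y₀ ∧ (∀ v, {v} ∈ X.faces → p (h v) = v) ∧
      ∀ u v, X.Edge u v → N (h u) (h v) := by
  have hex : ∀ y v, ∃ y', {p y, v} ∈ X.faces → p y' = v ∧ (y = y' ∨ N y y') := by
    intro y v
    by_cases h : X.Edge (p y) v
    · obtain ⟨y', h1, h2⟩ := hlift y v h
      exact ⟨y', fun _ => ⟨h2, Or.inr h1⟩⟩
    · refine ⟨y, fun h' => ⟨?_, Or.inl rfl⟩⟩
      by_contra hne
      exact h ⟨hne, h'⟩
  choose ℓ hℓ using hex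
  have hun : ∀ y y₁ y₂, (y = y₁ ∨ N y y₁) → (y = y₂ ∨ N y y₂) → p y₁ = p y₂ → y₁ = y₂ := by
    rintro y y₁ y₂ (rfl | h1) (rfl | h2) h
    · rfl
    · exact absurd h (hedge _ _ h2).ne
    · exact absurd h.symm (hedge _ _ h1).ne
    · exact huniq _ _ _ h1 h2 h
  have hself : ∀ y, {p y} ∈ X.faces → ℓ y (p y) = y := by
    intro y hy
    obtain ⟨h1, h2⟩ := hℓ y (p y) (by simpa using hy)
    exact hun y _ _ h2 (Or.inl rfl) h1
  have hcomp : ∀ y v w, {p y, v, w} ∈ X.faces → ℓ (ℓ y v) w = ℓ y w := by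
    intro y v w h
    obtain ⟨e1, e2, e3⟩ := X.pair_mem_of_triple h
    obtain ⟨p1, q1⟩ := hℓ y v e1
    obtain ⟨p2, q2⟩ := hℓ y w e3
    obtain ⟨p3, q3⟩ := hℓ (ℓ y v) w (p1.symm ▸ e2)
    refine hun _ _ _ q3 ?_ (p3.trans p2.symm)
    rcases q1 with q1 | q1
    · rwa [← q1]
    rcases q2 with q2 | q2
    · exact Or.inr (hsymm _ _ (q2 ▸ q1))
    by_cases hvw : v = w
    · exact Or.inl (congrArg _ hvw)
    refine Or.inr (htri _ _ _ q1 q2 ⟨(hedge _ _ q1).ne, ?_, (hedge _ _ q2).ne, ?_⟩) <;>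
      rwa [p1, p2]
  let F := {y // p y = p y₀}
  have hfib : ∀ v, {v} ∈ X.faces → ∃ (E : F → Y) (D : Y → F),
      (∀ f, p (E f) = v ∧ D (E f) = f) ∧ ∀ y, p y = v → E (D y) = y := by
    intro v hv
    refine X.forall_vertex_of_connected (fun v => ∃ (E : F → Y) (D : Y → F),
      (∀ f, p (E f) = v ∧ D (E f) = f) ∧ ∀ y, p y = v → E (D y) = y) ?_ hy₀ ?_ hv
    · rintro u v huv ⟨E, D, h1, h2⟩
      have hback : ∀ u v y, {u, v} ∈ X.faces → p y = u → p (ℓ y v) = v ∧ ℓ (ℓ y v) u = y := by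
        rintro _ v y h rfl
        refine ⟨(hℓ y v h).1, ?_⟩
        rw [hcomp y v _ (by convert h using 1; ext; simp; tauto)]
        exact hself y (X.down_closed _ h _ (by simp) (by simp))
      have hvu : {v, u} ∈ X.faces := by rwa [Finset.pair_comm]
      refine ⟨fun f => ℓ (E f) v, fun y => D (ℓ y u), fun f => ?_, fun y hy => ?_⟩
      · obtain ⟨h3, h4⟩ := hback u v _ huv (h1 f).1
        exact ⟨h3, (congrArg D h4).trans (h1 f).2⟩
      · obtain ⟨h3, h4⟩ := hback v u _ hvu hy
        dsimp only
        rw [h2 _ h3, h4]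
    · classical
      refine ⟨Subtype.val, fun y => if h : p y = p y₀ then ⟨y, h⟩ else ⟨y₀, rfl⟩,
        fun f => ⟨f.2, ?_⟩, fun y hy => ?_⟩
      · simp [f.2]
      · simp [hy]
  have hfib' : ∀ v, ∃ (E : F → Y) (D : Y → F), {v} ∈ X.faces →
      (∀ f, p (E f) = v ∧ D (E f) = f) ∧ ∀ y, p y = v → E (D y) = y := by
    intro v
    by_cases hv : {v} ∈ X.faces
    · obtain ⟨E, D, h⟩ := hfib v hv
      exact ⟨E, D, fun _ => h⟩
    · exact ⟨fun _ => y₀, fun _ => ⟨y₀, rfl⟩, fun h => absurd h hv⟩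
  choose E D hED using hfib'
  have hvert : ∀ {σ : Finset V} {v}, σ ∈ X.faces → v ∈ σ → {v} ∈ X.faces := fun hσ hv =>
    X.down_closed _ hσ _ (by simpa using hv) (by simp)
  obtain ⟨h, h0, hh⟩ := X.exists_section_of_localSystem (fun u v f => D v (ℓ (E u f) v))
    (by
      intro v hv f
      obtain ⟨h1, h2⟩ := (hED v hv).1 f
      have := hself (E v f) (by rwa [h1])
      rw [h1] at this
      rw [this, h2])
    (by
      intro u v w huvw f
      have hu : {u} ∈ X.faces := hvert huvw (by simp)
      have hv : {v} ∈ X.faces := hvert huvw (by simp)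
      obtain ⟨h1, h2⟩ := (hED u hu).1 f
      rw [(hED v hv).2 _ (hℓ _ _ (by rw [h1]; exact (X.pair_mem_of_triple huvw).1)).1,
        hcomp _ _ _ (by rwa [h1])])
    (p y₀) hy₀ (D (p y₀) y₀)
  refine ⟨fun v => E v (h v), ?_, fun v hv => ((hED v hv).1 _).1, fun u v huv => ?_⟩
  · dsimp only
    rw [h0, (hED _ hy₀).2 _ rfl]
  · have hu := hvert huv.mem (show u ∈ _ by simp)
    have hv := hvert huv.mem (show v ∈ _ by simp)
    have hpu := ((hED u hu).1 (h u)).1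
    obtain ⟨p1, q1⟩ := hℓ (E u (h u)) v (by rw [hpu]; exact huv.mem)
    have h3 : ℓ (E u (h u)) v = E v (h v) := by
      rw [← hh u v huv.mem, (hED v hv).2 _ p1]
    rw [h3] at p1 q1
    refine q1.resolve_left fun e => huv.ne ?_
    rw [← hpu, e, p1]

end Section

namespace Layer

variable {V : Type u} [DecidableEq V] {X : SComplex V} {hX : X.LocallyKLarge 6}
  {τ : Finset V} {hτ : τ ∈ X.faces}

variable (hX hτ) in
/-- The spheres of the development of `X` around `τ`. -/
def dev : ℕ → Layer X
  | 0 => base τ hτ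
  | i + 1 => (dev i).next hX

/-- Adjacency in the development. -/
inductive DevAdj : (Σ i, (dev hX hτ i).T) → (Σ i, (dev hX hτ i).T) → Prop
  | side {i : ℕ} {w w' : (dev hX hτ i).T} (h : (dev hX hτ i).adj w w') : DevAdj ⟨i, w⟩ ⟨i, w'⟩
  | up {i : ℕ} {w : (dev hX hτ i).T} {α : (dev hX hτ i).Next hX} (h : Next.IsParent w α) :
      DevAdj ⟨i, w⟩ ⟨i + 1, α⟩
  | down {i : ℕ} {w : (dev hX hτ i).T} {α : (dev hX hτ i).Next hX} (h : Next.IsParent w α) :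
      DevAdj ⟨i + 1, α⟩ ⟨i, w⟩

/-- The projection of the development to `X`. -/
def devProj (y : Σ i, (dev hX hτ i).T) : V := (dev hX hτ y.1).p y.2

namespace DevAdj

variable {y y₁ y₂ : Σ i, (dev hX hτ i).T}

lemma symm (h : DevAdj y y₁) : DevAdj y₁ y := by
  cases h with
  | side h => exact side (Layer.adj_symm _ h)
  | up h => exact down h
  | down h => exact up h

lemma edge (h : DevAdj y y₁) : X.Edge (devProj y) (devProj y₁) := by
  cases h with
  | side h => exact Layer.adj_edge _ h
  | up h => exact h.child.edge
  | down h => exact h.child.edge.symm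

lemma exists_of_edge {v : V} (h : X.Edge (devProj y) v) : ∃ y', DevAdj y y' ∧ devProj y' = v := by
  obtain ⟨i, w⟩ := y
  by_cases hp : v ∈ (dev hX hτ i).par w
  · cases i with
    | zero => exact absurd hp (Set.notMem_empty _)
    | succ i =>
      obtain ⟨w', hw', rfl⟩ := hp
      exact ⟨⟨i, w'⟩, down hw', rfl⟩
  by_cases ha : ∃ w', (dev hX hτ i).adj w w' ∧ (dev hX hτ i).p w' = v
  · obtain ⟨w', ha, rfl⟩ := ha
    exact ⟨⟨i, w'⟩, side ha, rfl⟩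
  · push Not at ha
    exact ⟨⟨i + 1, Next.mk hX w v ⟨h, hp, ha⟩⟩, up (Next.isParent_mk _), rfl⟩

lemma unique (h₁ : DevAdj y y₁) (h₂ : DevAdj y y₂) (hp : devProj y₁ = devProj y₂) : y₁ = y₂ := by
  have hud : ∀ {i} {w : (dev hX hτ (i + 1)).T} {w' : (dev hX hτ i).T}
      {α : (dev hX hτ (i + 1)).Next hX}, Next.IsParent w α → Next.IsParent w' w →
      α.proj ≠ (dev hX hτ i).p w' := fun h h' e => h.child.notMem_par ⟨_, h', e.symm⟩
  cases h₁ with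
  | side h =>
    cases h₂ with
    | side h' => rw [(dev hX hτ _).adj_inj h h' hp]
    | up h' => exact absurd hp (h'.child.ne _ h)
    | down h' => exact absurd ⟨_, h', hp.symm⟩ ((dev hX hτ _).adj_notMem_par h)
  | up h =>
    cases h₂ with
    | side h' => exact absurd hp.symm (h.child.ne _ h')
    | up h' => rw [h.eq h' hp]
    | down h' => exact absurd hp (hud h h')
  | down h =>
    cases h₂ with
    | side h' => exact absurd ⟨_, h, hp⟩ ((dev hX hτ _).adj_notMem_par h')
    | up h' => exact absurd hp.symm (hud h' h)
    | down h' => rw [h.inj h' hp]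

lemma of_tri (h₁ : DevAdj y y₁) (h₂ : DevAdj y y₂)
    (ht : X.Tri (devProj y) (devProj y₁) (devProj y₂)) : DevAdj y₁ y₂ := by
  have hud : ∀ {i} {w : (dev hX hτ (i + 1)).T} {w' : (dev hX hτ i).T}
      {α : (dev hX hτ (i + 1)).Next hX}, Next.IsParent w α → Next.IsParent w' w →
      ¬ X.Tri ((dev hX hτ (i + 1)).p w) α.proj ((dev hX hτ i).p w') := by
    intro i w w' α h h' t
    exact (dev hX hτ (i + 1)).child_not_tri (w := w) ⟨w', h', rfl⟩ t.cab h.child.notMem_par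
      h.child.ne
  cases h₁ with
  | side h =>
    cases h₂ with
    | side h' => exact side ((dev hX hτ _).adj_of_tri h h' ht)
    | up h' => exact up (h'.transfer h ht.cab)
    | down h' => exact down (Next.Adj.isParent h h' ht.cab)
  | up h =>
    cases h₂ with
    | side h' => exact down (h.transfer h' ht.bac)
    | up h' => exact side ⟨_, h, h', ht⟩
    | down h' => exact absurd ht (hud h h')
  | down h =>
    cases h₂ with
    | side h' => exact up (Next.Adj.isParent h' h ht.bac)
    | up h' => exact absurd ht.acb (hud h' h)
    | down h' => exact side ((h.rel h').resolve_left fun e => ht.ne₂₃ (by rw [e])).1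

lemma fst_le (h : DevAdj y y₁) : y₁.1 ≤ y.1 + 1 := by
  cases h <;> dsimp only <;> omega

lemma tri_of_lt (h₁ : DevAdj y y₁) (h₂ : DevAdj y y₂) (hl₁ : y₁.1 < y.1) (hl₂ : y₂.1 < y.1)
    (hne : devProj y₁ ≠ devProj y₂) : X.Tri (devProj y) (devProj y₁) (devProj y₂) := by
  cases h₁ with
  | side h => exact absurd hl₁ (lt_irrefl _)
  | up h => simp at hl₁
  | down h =>
    cases h₂ with
    | side h' => exact absurd hl₂ (lt_irrefl _)
    | up h' => simp at hl₂
    | down h' => exact ((h.rel h').resolve_left fun e => hne (by rw [e])).2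

end DevAdj

lemma exists_devAdj_fst_lt (y : Σ i, (dev hX hτ i).T) (hy : 0 < y.1) :
    ∃ y', DevAdj y y' ∧ y'.1 < y.1 := by
  obtain ⟨_ | i, α⟩ := y
  · exact absurd hy (lt_irrefl _)
  · obtain ⟨w, z, h, rfl⟩ := Next.exists_mk α
    exact ⟨⟨i, w⟩, .down (Next.isParent_mk h), i.lt_succ_self⟩

end Layer

/-- A systolic complex is isomorphic to its development around any simplex. -/
theorem exists_section_dev {V : Type u} [DecidableEq V] {X : SComplex V} (hX : X.Systolic)
    {τ : Finset V} (hτ : τ ∈ X.faces) :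
    ∃ h : V → Σ i, (Layer.dev hX.1 hτ i).T, (∀ v, {v} ∈ X.faces → Layer.devProj (h v) = v) ∧
      (∀ u v, X.Edge u v → Layer.DevAdj (h u) (h v)) ∧
      ∀ v, {v} ∈ X.faces → ∀ i, {v} ∈ X.ballFaces τ i ↔ (h v).1 ≤ i := by
  obtain ⟨hL, _, _⟩ := hX
  obtain ⟨t₀, ht₀⟩ := X.nonempty_of_mem τ hτ
  have hτv : ∀ t ∈ τ, {t} ∈ X.faces := fun t ht =>
    X.down_closed _ hτ _ (by simpa using ht) (by simp)
  obtain ⟨h, h0, hp, ha⟩ := exists_section_of_covering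
    (Layer.devProj (hX := hL) (hτ := hτ)) Layer.DevAdj
    (fun _ _ => Layer.DevAdj.symm) (fun _ _ => Layer.DevAdj.edge)
    (fun _ _ => Layer.DevAdj.exists_of_edge) (fun _ _ _ => Layer.DevAdj.unique)
    (fun _ _ _ => Layer.DevAdj.of_tri) ⟨0, (⟨t₀, ht₀⟩ : {v // v ∈ τ})⟩ (hτv t₀ ht₀)
  refine ⟨h, hp, ha, fun v hv i => ?_⟩
  change h t₀ = _ at h0
  have hbase : ∀ t (ht : t ∈ τ), h t = ⟨0, (⟨t, ht⟩ : {v // v ∈ τ})⟩ := by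
    intro t ht
    by_cases e : t = t₀
    · subst e
      exact h0
    have he : X.Edge t₀ t := ⟨Ne.symm e,
      X.down_closed _ hτ _ (by simp [Finset.insert_subset_iff, ht, ht₀]) (by simp)⟩
    have h1 := ha _ _ he
    rw [h0] at h1
    refine h1.unique (.side (show (_ : {v // v ∈ τ}) ≠ _ from fun e' =>
      he.ne (congrArg Subtype.val e'))) (hp t (hτv t ht))
  induction i generalizing v with
  | zero =>
    constructor
    · rintro ⟨-, hv⟩
      rw [hbase v (by simpa using hv)]
    · intro hv0
      refine ⟨hv, ?_⟩
      have h1 := hp v hv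
      generalize h v = y at h1 hv0
      obtain ⟨i, w⟩ := y
      obtain rfl : i = 0 := Nat.le_zero.1 hv0
      rw [← h1]
      exact Finset.singleton_subset_iff.2 w.2
  | succ i ih =>
    constructor
    · rintro ⟨-, σ, hσ, hvσ, u, hu, hub⟩
      have hu' : {u} ∈ X.faces := X.down_closed _ hσ _ (by simpa using hu) (by simp)
      have h1 := (ih u hu').1 hub
      by_cases e : u = v
      · exact e ▸ h1.trans i.le_succ
      have he : X.Edge u v := ⟨e, X.down_closed _ hσ _
        (Finset.insert_subset hu hvσ) (by simp)⟩
      exact (ha u v he).fst_le.trans (Nat.succ_le_succ h1)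
    · intro hl
      by_cases hl' : (h v).1 ≤ i
      · exact ⟨hv, {v}, hv, subset_rfl, v, by simp, (ih v hv).2 hl'⟩
      · obtain ⟨y, hy, hyl⟩ := Layer.exists_devAdj_fst_lt (h v) (by omega)
        have he := hy.edge
        rw [hp v hv] at he
        have hy' : {Layer.devProj y} ∈ X.faces :=
          X.down_closed _ he.mem _ (by simp) (by simp)
        have : y = h (Layer.devProj y) := hy.unique (ha _ _ he) (hp _ hy').symm
        refine ⟨hv, _, he.mem, by simp, Layer.devProj y, by simp, (ih _ hy').2 ?_⟩
        rw [← this]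
        omega

/-- Two neighbours of a vertex outside a ball that lie in the ball are adjacent. -/
theorem Systolic.tri_of_mem_ball {V : Type u} [DecidableEq V] {X : SComplex V} (hX : X.Systolic)
    {τ : Finset V} (hτ : τ ∈ X.faces) {i : ℕ} {v a b : V} (hv : {v} ∉ X.ballFaces τ i)
    (ha : {a} ∈ X.ballFaces τ i) (hb : {b} ∈ X.ballFaces τ i) (hva : X.Edge v a)
    (hvb : X.Edge v b) (hab : a ≠ b) : X.Tri v a b := by
  obtain ⟨h, hp, hadj, hball⟩ := exists_section_dev hX hτ
  have hv' : {v} ∈ X.faces := X.down_closed _ hva.mem _ (by simp) (by simp)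
  have ha' : {a} ∈ X.faces := X.down_closed _ hva.mem _ (by simp) (by simp)
  have hb' : {b} ∈ X.faces := X.down_closed _ hvb.mem _ (by simp) (by simp)
  rw [hball v hv'] at hv
  rw [hball a ha'] at ha
  rw [hball b hb'] at hb
  have := (hadj v a hva).tri_of_lt (hadj v b hvb) (by omega) (by omega)
    (by rwa [hp a ha', hp b hb'])
  rwa [hp v hv', hp a ha', hp b hb'] at this

section Chamber

variable {V : Type u} [DecidableEq V] {X : SComplex V}

/-- A set of vertices is a simplex if any two of its elements span a simplex together with a
fixed third one. -/
lemma LocallyKLarge.mem_faces (hX : X.LocallyKLarge 6) {v : V} {D : Finset V} (hv : v ∈ D)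
    (h : ∀ x ∈ D, ∀ y ∈ D, ∃ P ∈ X.faces, v ∈ P ∧ x ∈ P ∧ y ∈ P) : D ∈ X.faces := by
  have hsub : ∀ x ∈ D, ∀ y ∈ D, ∀ A : Finset V, A ⊆ {v, x, y} → A.Nonempty → A ∈ X.faces := by
    intro x hx y hy A hA hne
    obtain ⟨P, hP, h1, h2, h3⟩ := h x hx y hy
    refine X.down_closed P hP A (hA.trans ?_) hne
    simp [Finset.insert_subset_iff, h1, h2, h3]
  have hvf : {v} ∈ X.faces := hsub v hv v hv _ (by simp) (by simp)
  rcases (D.erase v).eq_empty_or_nonempty with he | he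
  · rw [← Finset.insert_erase hv, he]
    exact hvf
  have hlink : ∀ x ∈ D.erase v, ∀ y ∈ D.erase v, ∀ A : Finset V, A ⊆ {x, y} → A.Nonempty →
      A ∈ (X.link {v}).faces := by
    intro x hx y hy A hA hne
    rw [Finset.mem_erase] at hx hy
    refine ⟨hsub x hx.2 y hy.2 A (hA.trans (by simp)) hne, ?_,
      hsub x hx.2 y hy.2 _ ?_ (by simp)⟩
    · rw [Finset.disjoint_singleton_right]
      intro h
      have := hA h
      simp only [Finset.mem_insert, Finset.mem_singleton] at this
      rcases this with rfl | rfl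
      · exact hx.1 rfl
      · exact hy.1 rfl
    · exact Finset.union_subset (hA.trans (by simp)) (by simp)
  have := (hX {v} hvf).1 (D.erase v) he (fun x hx => hlink x hx x hx _ (by simp) (by simp))
    (fun x hx y hy _ => hlink x hx y hy _ subset_rfl (by simp))
  have h2 := this.2.2
  rwa [Finset.union_comm, ← Finset.insert_eq, Finset.insert_erase hv] at h2

lemma mem_sphere_succ {τ σ : Finset V} {i : ℕ} :
    σ ∈ (X.sphere τ (i + 1)).faces ↔ σ.Nonempty ∧ (∀ v ∈ σ, {v} ∉ X.ballFaces τ i) ∧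
      ∃ a, {a} ∈ X.ballFaces τ i ∧ insert a σ ∈ X.faces := by
  constructor
  · rintro ⟨⟨h1, μ, hμ, hσμ, a, ha, hab⟩, h2⟩
    exact ⟨X.nonempty_of_mem σ h1, h2, a, hab,
      X.down_closed _ hμ _ (Finset.insert_subset ha hσμ) (by simp)⟩
  · rintro ⟨hne, h2, a, hab, h⟩
    exact ⟨⟨X.down_closed _ h _ (Finset.subset_insert _ _) hne, _, h, Finset.subset_insert _ _, a,
      Finset.mem_insert_self _ _, hab⟩, h2⟩

/-- For every simplex `σ` of a sphere in a systolic complex, the vertices of the ball that span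
a simplex with `σ` form a simplex themselves, which moreover spans a simplex with `σ`. -/
lemma exists_projection (hX : X.Systolic) {N : ℕ} (hN : ∀ σ ∈ X.faces, σ.card ≤ N)
    {τ : Finset V} (hτ : τ ∈ X.faces) {i : ℕ} {σ : Finset V}
    (hσ : σ ∈ (X.sphere τ (i + 1)).faces) :
    ∃ ρ : Finset V, ρ.Nonempty ∧ (∀ a ∈ ρ, {a} ∈ X.ballFaces τ i) ∧ σ ∪ ρ ∈ X.faces ∧
      ∀ a, {a} ∈ X.ballFaces τ i → insert a σ ∈ X.faces → a ∈ ρ := by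
  obtain ⟨⟨v, hv⟩, hout, a₀, ha₀, hσ₀⟩ := mem_sphere_succ.1 hσ
  let s := {m : ℕ | ∃ ρ : Finset V, (ρ.Nonempty ∧ (∀ a ∈ ρ, {a} ∈ X.ballFaces τ i) ∧
    σ ∪ ρ ∈ X.faces) ∧ ρ.card = m}
  have hs : s.Nonempty := ⟨_, {a₀}, ⟨by simp, by simpa using ha₀, by
    rwa [Finset.union_comm, ← Finset.insert_eq]⟩, rfl⟩
  have hb : BddAbove s := by
    refine ⟨N, ?_⟩
    rintro _ ⟨ρ, ⟨-, -, h⟩, rfl⟩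
    exact (Finset.card_le_card Finset.subset_union_right).trans (hN _ h)
  obtain ⟨ρ, ⟨h1, h2, h3⟩, h4⟩ := Nat.sSup_mem hs hb
  refine ⟨ρ, h1, h2, h3, fun a ha hσa => ?_⟩
  by_contra haρ
  have hedge : ∀ b, {b} ∈ X.ballFaces τ i → ∀ P ∈ X.faces, v ∈ P → b ∈ P → X.Edge v b :=
    fun b hb P hP hvP hbP => ⟨fun e => hout v hv (e ▸ hb), X.down_closed _ hP _
      (Finset.insert_subset hvP (by simpa using hbP)) (by simp)⟩
  have key : ∀ b ∈ σ ∪ ρ, ∃ P ∈ X.faces, v ∈ P ∧ a ∈ P ∧ b ∈ P := by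
    intro b hb
    rcases Finset.mem_union.1 hb with hbσ | hbρ
    · exact ⟨_, hσa, by simp [hv], by simp, by simp [hbσ]⟩
    · exact ⟨_, (hX.tri_of_mem_ball hτ (hout v hv) ha (h2 b hbρ)
        (hedge a ha _ hσa (by simp [hv]) (by simp)) (hedge b (h2 b hbρ) _ h3 (by simp [hv]) hb)
        fun e => haρ (e ▸ hbρ)).mem, by simp, by simp, by simp⟩
  have hins : insert a (σ ∪ ρ) ∈ X.faces := by
    refine hX.1.mem_faces (v := v) (by simp [hv]) fun x hx y hy => ?_
    rcases Finset.mem_insert.1 hx with ex | hx' <;> rcases Finset.mem_insert.1 hy with ey | hy'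
    · exact ⟨_, hσa, by simp [hv], by simp [ex], by simp [ey]⟩
    · exact ex ▸ key y hy'
    · obtain ⟨P, hP, p1, p2, p3⟩ := key x hx'
      exact ⟨P, hP, p1, p3, ey ▸ p2⟩
    · exact ⟨_, h3, by simp [hv], hx', hy'⟩
  have : (insert a ρ).card ≤ sSup s := le_csSup hb ⟨_, ⟨by simp, by simpa [ha] using h2, by
    rwa [Finset.union_insert]⟩, rfl⟩
  rw [Finset.card_insert_of_notMem haρ] at this
  omega

variable {n : ℕ}

/-- In a chamber complex, every codimension-one face of a chamber lies in another chamber. -/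
lemma IsChamberComplex.exists_insert_erase (hcc : X.IsChamberComplex n) (hn : 1 ≤ n)
    {C : Finset V} (hC : C ∈ X.faces) (hcard : C.card = n + 1) {v : V} (hv : v ∈ C) :
    ∃ w ∉ C, insert w (C.erase v) ∈ X.faces := by
  have hce : (C.erase v).card = n := by rw [Finset.card_erase_of_mem hv, hcard]; rfl
  have hmem : C.erase v ∈ X.faces :=
    X.down_closed _ hC _ (Finset.erase_subset _ _) (Finset.card_pos.1 (by omega))
  have key : ∀ C' ∈ X.faces, C.erase v ⊆ C' → C'.card = n + 1 → C' ≠ C →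
      ∃ w ∉ C, insert w (C.erase v) ∈ X.faces := by
    intro C' hC' hsub hc' hne
    obtain ⟨w, hw, hwC⟩ := Finset.not_subset.1 fun h =>
      hne (Finset.eq_of_subset_of_card_le h (by omega))
    exact ⟨w, hwC, X.down_closed _ hC' _ (Finset.insert_subset hw hsub) (by simp)⟩
  obtain ⟨C₁, h1, C₂, h2, hne, s1, s2, c1, c2⟩ := hcc.2.2 _ hmem hce
  by_cases e : C₁ = C
  · exact key C₂ h2 s2 c2 fun e' => hne (e.trans e'.symm)
  · exact key C₁ h1 s1 c1 e

/-- In a chamber complex, every codimension-one face has two distinct opposite vertices. -/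
lemma IsChamberComplex.exists_insert_insert (hcc : X.IsChamberComplex n) {D : Finset V}
    (hD : D ∈ X.faces) (hcard : D.card = n) :
    ∃ w w', w ≠ w' ∧ w ∉ D ∧ w' ∉ D ∧ insert w D ∈ X.faces ∧ insert w' D ∈ X.faces := by
  have key : ∀ C : Finset V, D ⊆ C → C.card = n + 1 → ∃ w ∉ D, insert w D = C := by
    intro C hDC hC
    obtain ⟨w, hw⟩ := Finset.card_eq_one.1 (show (C \ D).card = 1 by
      rw [Finset.card_sdiff_of_subset hDC]; omega)
    refine ⟨w, fun h => ?_, ?_⟩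
    · have : w ∈ C \ D := by simp [hw]
      exact (Finset.mem_sdiff.1 this).2 h
    · rw [Finset.insert_eq, ← hw, Finset.sdiff_union_of_subset hDC]
  obtain ⟨C₁, h1, C₂, h2, hne, s1, s2, c1, c2⟩ := hcc.2.2 _ hD hcard
  obtain ⟨w, hw, rfl⟩ := key _ s1 c1
  obtain ⟨w', hw', rfl⟩ := key _ s2 c2
  exact ⟨w, w', fun e => hne (e ▸ rfl), hw, hw', h1, h2⟩

variable {τ σ : Finset V} {i : ℕ}

lemma sphere_card_le (hcc : X.IsChamberComplex n)
    (hσ : σ ∈ (X.sphere τ (i + 1)).faces) : σ.card ≤ n := by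
  obtain ⟨-, hout, a, ha, h⟩ := mem_sphere_succ.1 hσ
  have := hcc.1 _ h
  rw [Finset.card_insert_of_notMem fun h => hout a h ha] at this
  omega

lemma insert_mem_sphere {ρ : Finset V} (hρB : ∀ a ∈ ρ, {a} ∈ X.ballFaces τ i)
    (hout : ∀ v ∈ σ, {v} ∉ X.ballFaces τ i)
    (hmax : ∀ a, {a} ∈ X.ballFaces τ i → insert a σ ∈ X.faces → a ∈ ρ) {w : V}
    (hw : w ∉ σ ∪ ρ) (a : V) (ha : a ∈ ρ) (C : Finset V) (hC : C ∈ X.faces) (hσC : σ ⊆ C)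
    (haC : a ∈ C) (hwC : w ∈ C) : w ∉ σ ∧ insert w σ ∈ (X.sphere τ (i + 1)).faces := by
  rw [Finset.mem_union, not_or] at hw
  refine ⟨hw.1, mem_sphere_succ.2 ⟨by simp, ?_, a, hρB a ha, X.down_closed _ hC _
    (Finset.insert_subset haC (Finset.insert_subset hwC hσC)) (by simp)⟩⟩
  intro v hv
  rcases Finset.mem_insert.1 hv with rfl | hv
  · exact fun hB => hw.2 (hmax _ hB (X.down_closed _ hC _ (Finset.insert_subset hwC hσC)
      (by simp)))
  · exact hout v hv

lemma sphere_exists_insert (hX : X.Systolic) (hcc : X.IsChamberComplex n) (hτ : τ ∈ X.faces)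
    (hσ : σ ∈ (X.sphere τ (i + 1)).faces) (hcard : σ.card < n) :
    ∃ w ∉ σ, insert w σ ∈ (X.sphere τ (i + 1)).faces := by
  obtain ⟨ρ, hρ, hρB, hσρ, hmax⟩ := exists_projection hX hcc.1 hτ hσ
  obtain ⟨-, hout, -⟩ := mem_sphere_succ.1 hσ
  obtain ⟨C, hC, hsub, hCcard⟩ := hcc.2.1 _ hσρ
  by_cases he : C ⊆ σ ∪ ρ
  · obtain rfl := hsub.antisymm he
    have hc2 := Finset.card_union_le σ ρ
    obtain ⟨a, ha, b, hb, hab⟩ := Finset.one_lt_card.1 (show 1 < ρ.card by omega)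
    obtain ⟨w, hw, hins⟩ := hcc.exists_insert_erase (by omega) hC hCcard
      (Finset.mem_union_right σ ha)
    refine ⟨w, insert_mem_sphere hρB hout hmax hw b hb _ hins (fun v hv => ?_) (by simp [hb, hab.symm]) (by simp)⟩
    have : v ≠ a := fun e => hout v hv (e ▸ hρB a ha)
    simp [hv, this]
  · obtain ⟨w, hw, hw'⟩ := Finset.not_subset.1 he
    obtain ⟨a, ha⟩ := hρ
    exact ⟨w, insert_mem_sphere hρB hout hmax hw' a ha C hC (Finset.subset_union_left.trans hsub)
      (hsub (Finset.mem_union_right _ ha)) hw⟩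

lemma sphere_exists_insert_insert (hX : X.Systolic) (hcc : X.IsChamberComplex n)
    (hτ : τ ∈ X.faces) (hσ : σ ∈ (X.sphere τ (i + 1)).faces) (hcard : σ.card + 1 = n) :
    ∃ w w', w ≠ w' ∧ w ∉ σ ∧ w' ∉ σ ∧ insert w σ ∈ (X.sphere τ (i + 1)).faces ∧
      insert w' σ ∈ (X.sphere τ (i + 1)).faces := by
  obtain ⟨ρ, hρ, hρB, hσρ, hmax⟩ := exists_projection hX hcc.1 hτ hσ
  obtain ⟨⟨v, hv⟩, hout, -⟩ := mem_sphere_succ.1 hσ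
  have key := fun w => insert_mem_sphere (w := w) hρB hout hmax
  have hdisj : Disjoint σ ρ := Finset.disjoint_left.2 fun v h h' => hout v h (hρB v h')
  have hle := hcc.1 _ hσρ
  have hcu := Finset.card_union_of_disjoint hdisj
  have hpos := hρ.card_pos
  obtain h1 | h2 : ρ.card = 1 ∨ ρ.card = 2 := by omega
  · obtain ⟨w, w', hne, hw, hw', m, m'⟩ := hcc.exists_insert_insert hσρ (by omega)
    obtain ⟨a, ha⟩ := hρ
    have hsub : ∀ u, σ ⊆ insert u (σ ∪ ρ) := fun u =>
      Finset.subset_union_left.trans (Finset.subset_insert _ _)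
    have := key w hw a ha _ m (hsub _) (by simp [ha]) (by simp)
    have := key w' hw' a ha _ m' (hsub _) (by simp [ha]) (by simp)
    tauto
  · obtain ⟨a, b, hab, rfl⟩ := Finset.card_eq_two.1 h2
    have haσ : a ∉ σ := Finset.disjoint_right.1 hdisj (by simp)
    have hbσ : b ∉ σ := Finset.disjoint_right.1 hdisj (by simp)
    obtain ⟨w, hw, m⟩ := hcc.exists_insert_erase (by omega) hσρ (by omega)
      (show a ∈ _ by simp)
    obtain ⟨w', hw', m'⟩ := hcc.exists_insert_erase (by omega) hσρ (by omega)
      (show b ∈ _ by simp)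
    have hsub : ∀ {u c}, c ∉ σ → σ ⊆ insert u ((σ ∪ {a, b}).erase c) := fun hc x hx =>
      Finset.mem_insert_of_mem (Finset.mem_erase.2
        ⟨fun e => hc (e ▸ hx), Finset.mem_union_left _ hx⟩)
    obtain ⟨k1, k2⟩ := key w hw b (by simp) _ m (hsub haσ) (by simp [hab.symm]) (by simp)
    obtain ⟨k3, k4⟩ := key w' hw' a (by simp) _ m' (hsub hbσ) (by simp [hab]) (by simp)
    refine ⟨w, w', ?_, k1, k3, k2, k4⟩
    rintro rfl
    have hmem : ∀ {c x}, x ∈ insert w (σ ∪ {a, b}) → x ≠ c →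
        x ∈ insert w ((σ ∪ {a, b}).erase c) := by
      simp only [Finset.mem_insert, Finset.mem_erase]
      tauto
    have hbig : insert w (σ ∪ {a, b}) ∈ X.faces := by
      refine hX.1.mem_faces (v := v) (by simp [hv]) fun x hx y hy => ?_
      by_cases ha : x ≠ a ∧ y ≠ a
      · exact ⟨_, m, hsub haσ hv, hmem hx ha.1, hmem hy ha.2⟩
      by_cases hb : x ≠ b ∧ y ≠ b
      · exact ⟨_, m', hsub hbσ hv, hmem hx hb.1, hmem hy hb.2⟩
      refine ⟨_, hσρ, Finset.mem_union_left _ hv, Finset.mem_union_right _ ?_,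
        Finset.mem_union_right _ ?_⟩ <;> simp only [Finset.mem_insert, Finset.mem_singleton] <;>
        grind only
    have := hcc.1 _ hbig
    rw [Finset.card_insert_of_notMem hw] at this
    omega

end Chamber

end SComplex

/-- **Lemma (Osajda, Lemma 4.1).** Let `X` be a systolic chamber complex of dimension
`n ≥ 1` and `τ` a simplex of `X`. Then for every `k ≥ 1` the sphere `S_k(τ,X)` is an
`(n-1)`-dimensional chamber complex. -/
theorem sphere_is_chamber_complex {V : Type} [DecidableEq V] (X : SComplex V)
    (n : ℕ) (hn : 1 ≤ n) (hsys : X.Systolic) (hcc : X.IsChamberComplex n)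
    (τ : Finset V) (hτ : τ ∈ X.faces) (k : ℕ) (hk : 1 ≤ k) :
    (X.sphere τ k).IsChamberComplex (n - 1) := by
  obtain ⟨i, rfl⟩ : ∃ i, k = i + 1 := ⟨k - 1, by omega⟩
  have hn' : n - 1 + 1 = n := by omega
  refine ⟨fun σ hσ => hn'.symm ▸ SComplex.sphere_card_le hcc hσ, ?_, ?_⟩
  · rw [hn']
    intro σ hσ
    induction h : n - σ.card generalizing σ with
    | zero => exact ⟨σ, hσ, subset_rfl, by have := SComplex.sphere_card_le hcc hσ; omega⟩
    | succ d ih =>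
      obtain ⟨w, hw, hins⟩ := SComplex.sphere_exists_insert hsys hcc hτ hσ (by omega)
      have hc := Finset.card_insert_of_notMem hw
      obtain ⟨C, hC, hsub, hcard⟩ := ih _ hins (by omega)
      exact ⟨C, hC, (Finset.subset_insert w σ).trans hsub, hcard⟩
  · intro σ hσ hcard
    obtain ⟨w, w', hne, hw, hw', m, m'⟩ :=
      SComplex.sphere_exists_insert_insert hsys hcc hτ hσ (by omega)
    refine ⟨_, m, _, m', fun e => ?_, Finset.subset_insert _ _, Finset.subset_insert _ _,
      by rw [Finset.card_insert_of_notMem hw, hcard],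
      by rw [Finset.card_insert_of_notMem hw', hcard]⟩
    have : w ∈ insert w' σ := e ▸ Finset.mem_insert_self w σ
    exact (Finset.mem_insert.1 this).elim hne hw
end
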